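/- arXiv:0908.3973 — 3 statements merged into one kernel-verified Lean document; each statement's English description precedes it below -/
import Mathlib

section
/- Khintchine's theorem: Let Ψ : ℝ_{≥1} → ℝ_{>0} be a non-increasing function. If the series Σ_{n≥1} Ψ(n) converges, then for Lebesgue-almost all real ξ the inequality |qξ − p| < Ψ(q) has only finitely many solutions in integers p and positive integers q. If the series Σ_{n≥1} Ψ(n) diverges, then for Lebesgue-almost all real ξ the inequality |qξ − p| < Ψ(q) has infinitely many solutions in integers p and positive integers q. -/
open MeasureTheory

/-- A linearised Cauchy–Schwarz inequality for sums of indicator functions: it bounds the measure of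
a finite union from below in terms of the measures of the pairwise intersections. -/
lemma two_mul_sum_measureReal_le {α ι : Type*} [MeasurableSpace α] {μ : Measure α} (I : Finset ι)
    {B : ι → Set α} (hB : ∀ i, MeasurableSet (B i)) (hμ : ∀ i, μ (B i) ≠ ⊤) (t : ℝ) :
    2 * t * ∑ i ∈ I, μ.real (B i) ≤
      ∑ i ∈ I, ∑ j ∈ I, μ.real (B i ∩ B j) + t ^ 2 * μ.real (⋃ i ∈ I, B i) := by
  have hU : MeasurableSet (⋃ i ∈ I, B i) := I.measurableSet_biUnion fun i _ => hB i
  have hUμ : μ (⋃ i ∈ I, B i) ≠ ⊤ :=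
    (measure_biUnion_lt_top I.finite_toSet fun i _ => (hμ i).lt_top).ne
  have hint : ∀ s : Set α, MeasurableSet s → μ s ≠ ⊤ →
      Integrable (s.indicator (1 : α → ℝ)) μ := fun s hs hsμ =>
    (integrable_indicator_iff hs).2 (integrableOn_const hsμ)
  have hI : ∀ i, Integrable ((B i).indicator (1 : α → ℝ)) μ := fun i => hint _ (hB i) (hμ i)
  have hII : ∀ i j, Integrable ((B i ∩ B j).indicator (1 : α → ℝ)) μ := fun i j =>
    hint _ ((hB i).inter (hB j)) (measure_ne_top_of_subset Set.inter_subset_left (hμ i))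
  have hS : Integrable (fun x => ∑ i ∈ I, ∑ j ∈ I, (B i ∩ B j).indicator (1 : α → ℝ) x) μ :=
    integrable_finsetSum _ fun i _ => integrable_finsetSum _ fun j _ => hII i j
  have key : ∫ x, 2 * t * ∑ i ∈ I, (B i).indicator (1 : α → ℝ) x ∂μ ≤
      ∫ x, (∑ i ∈ I, ∑ j ∈ I, (B i ∩ B j).indicator (1 : α → ℝ) x +
        t ^ 2 * (⋃ i ∈ I, B i).indicator (1 : α → ℝ) x) ∂μ := by
    refine integral_mono ((integrable_finsetSum _ fun i _ => hI i).const_mul _)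
      (hS.add ((hint _ hU hUμ).const_mul _)) fun x => ?_
    have hsq : ∑ i ∈ I, ∑ j ∈ I, (B i ∩ B j).indicator (1 : α → ℝ) x =
        (∑ i ∈ I, (B i).indicator (1 : α → ℝ) x) ^ 2 := by
      simp only [Set.inter_indicator_one, Pi.mul_apply, sq, Finset.sum_mul_sum]
    simp only [hsq]
    by_cases hx : x ∈ ⋃ i ∈ I, B i
    · rw [Set.indicator_of_mem hx, Pi.one_apply]
      nlinarith [sq_nonneg (∑ i ∈ I, (B i).indicator (1 : α → ℝ) x - t)]
    · have : ∑ i ∈ I, (B i).indicator (1 : α → ℝ) x = 0 :=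
        Finset.sum_eq_zero fun i hi =>
          Set.indicator_of_notMem (fun h => hx (Set.mem_biUnion hi h)) _
      rw [Set.indicator_of_notMem hx, this]
      simp
  rw [integral_const_mul, integral_finsetSum _ fun i _ => hI i,
    integral_add hS ((hint _ hU hUμ).const_mul _), integral_const_mul, integral_indicator_one hU,
    integral_finsetSum _ fun i _ => integrable_finsetSum _ fun j _ => hII i j] at key
  simp only [integral_finsetSum _ fun j _ => hII _ j, integral_indicator_one (hB _),
    integral_indicator_one ((hB _).inter (hB _))] at key
  exact key

/-- A finite set of `s`-separated rationals in an interval of length `L` has at most `1 + L / s`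
elements. -/
lemma card_le_one_add_div_of_separated (T : Finset ℚ) {a L s : ℝ} (hL : 0 ≤ L) (hs : 0 < s)
    (hT : ∀ x ∈ T, a ≤ (x : ℝ) ∧ (x : ℝ) ≤ a + L)
    (hsep : ∀ x ∈ T, ∀ y ∈ T, x ≠ y → s ≤ |(x : ℝ) - y|) :
    (T.card : ℝ) ≤ 1 + L / s := by
  have hcard : T.card ≤ (Finset.range (⌊L / s⌋₊ + 1)).card := by
    refine Finset.card_le_card_of_injOn (fun x : ℚ => ⌊((x : ℝ) - a) / s⌋₊) (fun x hx => ?_) ?_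
    · have := hT x hx
      simp only [Finset.coe_range, Set.mem_Iio, Nat.lt_add_one_iff]
      gcongr
      linarith
    · intro x hx y hy hxy
      by_contra hne
      have hd := hsep x hx y hy hne
      have hx0 : 0 ≤ ((x : ℝ) - a) / s := div_nonneg (by linarith [hT x hx]) hs.le
      have hy0 : 0 ≤ ((y : ℝ) - a) / s := div_nonneg (by linarith [hT y hy]) hs.le
      have h1 := Nat.floor_le hx0
      have h2 := Nat.lt_floor_add_one (((x : ℝ) - a) / s)
      have h3 := Nat.floor_le hy0
      have h4 := Nat.lt_floor_add_one (((y : ℝ) - a) / s)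
      simp only at hxy
      rw [hxy] at h1 h2
      have h5 : |((x : ℝ) - a) / s - ((y : ℝ) - a) / s| < 1 := by
        rw [abs_lt]; constructor <;> linarith
      rw [← sub_div, abs_div, abs_of_pos hs, div_lt_one hs, sub_sub_sub_cancel_right] at h5
      linarith
  rw [Finset.card_range] at hcard
  calc (T.card : ℝ) ≤ (⌊L / s⌋₊ : ℝ) + 1 := by exact_mod_cast hcard
    _ ≤ 1 + L / s := by linarith [Nat.floor_le (div_nonneg hL hs.le)]

/-- Distinct rationals with denominators `a` and `b` differ by at least `1 / (a * b)`. -/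
lemma one_div_den_mul_den_le_abs_sub {x y : ℚ} (h : x ≠ y) :
    1 / ((x.den : ℝ) * y.den) ≤ |(x : ℝ) - y| := by
  have hx : (0 : ℝ) < x.den := Nat.cast_pos.2 x.pos
  have hy : (0 : ℝ) < y.den := Nat.cast_pos.2 y.pos
  have hne : x.num * y.den - y.num * x.den ≠ 0 := fun h0 =>
    h (Rat.eq_iff_mul_eq_mul.2 (sub_eq_zero.1 h0))
  have h1 : (1 : ℝ) ≤ |(x.num : ℝ) * y.den - y.num * x.den| := by
    exact_mod_cast Int.one_le_abs hne
  rw [Rat.cast_def x, Rat.cast_def y, div_sub_div _ _ hx.ne' hy.ne', abs_div,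
    abs_of_pos (mul_pos hx hy), mul_comm (x.den : ℝ) (y.num : ℝ)]
  gcongr

lemma finite_setOf_den_le_abs_le (N : ℕ) : {x : ℚ | x.den ≤ N ∧ |x| ≤ 2}.Finite := by
  refine Set.Finite.of_finite_image (f := fun x : ℚ => (x.num, x.den))
    (((Set.finite_Icc (-(2 * N : ℤ)) (2 * N)).prod (Set.finite_Iic N)).subset ?_) ?_
  · rintro _ ⟨x, ⟨hN, hx⟩, rfl⟩
    refine ⟨?_, hN⟩
    rw [← Rat.num_div_den x, abs_div, Nat.abs_cast,
      div_le_iff₀ (Nat.cast_pos.2 x.pos)] at hx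
    have h1 : |x.num| ≤ 2 * (x.den : ℤ) := by exact_mod_cast hx
    have h2 : |x.num| ≤ 2 * (N : ℤ) := by omega
    exact abs_le.1 h2
  · intro x _ y _ h
    simp only [Prod.mk.injEq] at h
    exact Rat.ext h.1 h.2

/-- The rationals of absolute value at most `2` and denominator at most `N`. -/
noncomputable def fareyFinset (N : ℕ) : Finset ℚ := (finite_setOf_den_le_abs_le N).toFinset

lemma mem_fareyFinset {N : ℕ} {x : ℚ} : x ∈ fareyFinset N ↔ x.den ≤ N ∧ |x| ≤ 2 := by
  simp [fareyFinset]

lemma fareyFinset_bounds {N : ℕ} {x : ℚ} (hx : x ∈ fareyFinset N) :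
    -2 ≤ (x : ℝ) ∧ (x : ℝ) ≤ 2 := by
  have := abs_le.1 (mem_fareyFinset.1 hx).2
  exact ⟨by exact_mod_cast this.1, by exact_mod_cast this.2⟩

lemma fareyFinset_separated {N : ℕ} {x y : ℚ} (hx : x ∈ fareyFinset N) (hy : y ∈ fareyFinset N)
    (h : x ≠ y) : 1 / (N : ℝ) ^ 2 ≤ |(x : ℝ) - y| := by
  refine le_trans ?_ (one_div_den_mul_den_le_abs_sub h)
  have hx0 : (0 : ℝ) < x.den := Nat.cast_pos.2 x.pos
  have hy0 : (0 : ℝ) < y.den := Nat.cast_pos.2 y.pos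
  have hx1 : (x.den : ℝ) ≤ N := by exact_mod_cast (mem_fareyFinset.1 hx).1
  have hy1 : (y.den : ℝ) ≤ N := by exact_mod_cast (mem_fareyFinset.1 hy).1
  rw [sq]
  gcongr

lemma card_fareyFinset_le {N : ℕ} (hN : 0 < N) :
    ((fareyFinset N).card : ℝ) ≤ 5 * (N : ℝ) ^ 2 := by
  have hN1 : (1 : ℝ) ≤ N := by exact_mod_cast hN
  have := card_le_one_add_div_of_separated (fareyFinset N) (a := -2) (L := 4)
    (s := 1 / (N : ℝ) ^ 2) (by norm_num) (by positivity)
    (fun x hx => by have := fareyFinset_bounds hx; constructor <;> linarith)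
    (fun x hx y hy h => fareyFinset_separated hx hy h)
  rw [div_div_eq_mul_div, div_one] at this
  nlinarith

lemma card_fareyFinset_filter_abs_sub_lt_le {N : ℕ} (hN : 0 < N) (c : ℝ) {ρ : ℝ} (hρ : 0 ≤ ρ) :
    (((fareyFinset N).filter fun x : ℚ => |c - x| < ρ).card : ℝ) ≤
      1 + 2 * ρ * (N : ℝ) ^ 2 := by
  have hN1 : (0 : ℝ) < N := by exact_mod_cast hN
  have := card_le_one_add_div_of_separated ((fareyFinset N).filter fun x : ℚ => |c - x| < ρ)
    (a := c - ρ) (L := 2 * ρ) (s := 1 / (N : ℝ) ^ 2) (by positivity) (by positivity)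
    (fun x hx => by
      have := abs_lt.1 (Finset.mem_filter.1 hx).2
      constructor <;> linarith)
    (fun x hx y hy h =>
      fareyFinset_separated (Finset.mem_filter.1 hx).1 (Finset.mem_filter.1 hy).1 h)
  rwa [div_div_eq_mul_div, div_one] at this

lemma card_fareyFinset_filter_den_eq_le (N : ℕ) {d : ℕ} (hd : 0 < d) :
    (((fareyFinset N).filter fun x : ℚ => x.den = d).card : ℝ) ≤ 5 * d := by
  have hd1 : (1 : ℝ) ≤ d := by exact_mod_cast hd
  have := card_le_one_add_div_of_separated ((fareyFinset N).filter fun x : ℚ => x.den = d)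
    (a := -2) (L := 4) (s := 1 / (d : ℝ)) (by norm_num) (by positivity)
    (fun x hx => by
      have := fareyFinset_bounds (Finset.mem_filter.1 hx).1; constructor <;> linarith)
    (fun x hx y hy h => by
      have hxd : (x.den : ℝ) = d := by exact_mod_cast (Finset.mem_filter.1 hx).2
      have hyd : (y.den : ℝ) = d := by exact_mod_cast (Finset.mem_filter.1 hy).2
      have hne : x.num - y.num ≠ 0 := fun h0 => h <| Rat.ext (sub_eq_zero.1 h0)
        ((Finset.mem_filter.1 hx).2.trans (Finset.mem_filter.1 hy).2.symm)
      have h1 : (1 : ℝ) ≤ |(x.num : ℝ) - y.num| := by exact_mod_cast Int.one_le_abs hne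
      rw [Rat.cast_def x, Rat.cast_def y, hxd, hyd, ← sub_div, abs_div, Nat.abs_cast]
      gcongr)
  rw [div_div_eq_mul_div, div_one] at this
  linarith

lemma sum_fareyFinset_one_div_den_le {N : ℕ} (hN : 0 < N) :
    ∑ x ∈ fareyFinset N, 1 / (x.den : ℝ) ≤ N / 4 + 20 / N * (fareyFinset N).card := by
  have hN1 : (0 : ℝ) < N := by exact_mod_cast hN
  rw [← Finset.sum_filter_add_sum_filter_not (fareyFinset N) fun x : ℚ => x.den ≤ N / 20]
  refine add_le_add ?_ ?_
  · rw [← Finset.sum_fiberwise_of_maps_to (t := Finset.Icc 1 (N / 20)) (g := fun x : ℚ => x.den)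
      fun x hx => Finset.mem_Icc.2 ⟨x.pos, (Finset.mem_filter.1 hx).2⟩]
    calc _ ≤ ∑ d ∈ Finset.Icc 1 (N / 20), (5 : ℝ) := Finset.sum_le_sum fun d hd => ?_
      _ = 5 * ((N / 20 : ℕ) : ℝ) := by simp [mul_comm]
      _ ≤ 5 * ((N : ℝ) / 20) := by gcongr; exact Nat.cast_div_le
      _ = N / 4 := by ring
    have hd0 : 0 < d := (Finset.mem_Icc.1 hd).1
    have hd1 : (0 : ℝ) < d := by exact_mod_cast hd0
    rw [Finset.sum_congr rfl (g := fun _ => 1 / (d : ℝ)) fun x hx => by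
      rw [(Finset.mem_filter.1 hx).2], Finset.sum_const, nsmul_eq_mul, mul_one_div,
      div_le_iff₀ hd1]
    refine le_trans ?_ (card_fareyFinset_filter_den_eq_le N hd0)
    gcongr
    exact Finset.filter_subset _ _
  · calc _ ≤ ∑ x ∈ (fareyFinset N).filter fun x : ℚ => ¬ x.den ≤ N / 20, (20 / N : ℝ) :=
        Finset.sum_le_sum fun x hx => ?_
      _ ≤ 20 / N * (fareyFinset N).card := by
        rw [Finset.sum_const, nsmul_eq_mul, mul_comm]
        gcongr
        exact Finset.filter_subset _ _
    have h1 : N < 20 * x.den := by have := (Finset.mem_filter.1 hx).2; omega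
    have h2 : (N : ℝ) ≤ 20 * x.den := by exact_mod_cast h1.le
    rw [div_le_div_iff₀ (Nat.cast_pos.2 x.pos) hN1]
    linarith

lemma Icc_subset_biUnion_fareyFinset {N : ℕ} (hN : 0 < N) :
    Set.Icc (0 : ℝ) 1 ⊆
      ⋃ x ∈ fareyFinset N, Metric.closedBall (x : ℝ) (1 / N * (1 / (x.den : ℝ))) := by
  intro ξ hξ
  have hN1 : (1 : ℝ) ≤ N := by exact_mod_cast hN
  obtain ⟨x, hx, hden⟩ := Real.exists_rat_abs_sub_le_and_den_le ξ hN
  have hd1 : (1 : ℝ) ≤ x.den := by exact_mod_cast x.pos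
  have hle : |ξ - x| ≤ 1 / N * (1 / (x.den : ℝ)) := by
    refine hx.trans ?_
    rw [one_div_mul_one_div]
    gcongr
    linarith
  have h1 : 1 / (N : ℝ) * (1 / (x.den : ℝ)) ≤ 1 :=
    mul_le_one₀ ((div_le_one (by linarith)).2 hN1) (by positivity)
      ((div_le_one (by linarith)).2 hd1)
  refine Set.mem_biUnion (x := x) (mem_fareyFinset.2 ⟨hden, ?_⟩) ?_
  · have h2 := abs_le.1 (hle.trans h1)
    have h3 : |(x : ℝ)| ≤ 2 := abs_le.2 ⟨by linarith [hξ.1], by linarith [hξ.2]⟩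
    exact_mod_cast h3
  · rwa [Metric.mem_closedBall, Real.dist_eq]

lemma le_card_fareyFinset {N : ℕ} (hN : 0 < N) :
    (N : ℝ) ^ 2 / 80 ≤ (fareyFinset N).card := by
  have hN1 : (0 : ℝ) < N := by exact_mod_cast hN
  have h1 : (1 : ℝ) ≤ ∑ x ∈ fareyFinset N, 2 * (1 / N * (1 / (x.den : ℝ))) := by
    calc (1 : ℝ) = volume.real (Set.Icc (0 : ℝ) 1) := by simp
      _ ≤ volume.real (⋃ x ∈ fareyFinset N,
            Metric.closedBall (x : ℝ) (1 / N * (1 / (x.den : ℝ)))) :=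
          measureReal_mono (Icc_subset_biUnion_fareyFinset hN)
            (measure_biUnion_lt_top (Finset.finite_toSet _)
              fun x _ => measure_closedBall_lt_top).ne
      _ ≤ ∑ x ∈ fareyFinset N,
            volume.real (Metric.closedBall (x : ℝ) (1 / N * (1 / (x.den : ℝ)))) :=
          measureReal_biUnion_finset_le _ _
      _ = _ := Finset.sum_congr rfl fun x _ => Real.volume_real_closedBall (by positivity)
  rw [← Finset.mul_sum, ← Finset.mul_sum] at h1
  have h2 := mul_le_mul_of_nonneg_left (sum_fareyFinset_one_div_den_le hN)
    (by positivity : (0 : ℝ) ≤ 2 * (1 / N))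
  have h3 : 2 * (1 / (N : ℝ)) * (N / 4 + 20 / N * (fareyFinset N).card) =
      1 / 2 + 40 * (fareyFinset N).card / (N : ℝ) ^ 2 := by
    field_simp
    ring
  have h4 : (1 : ℝ) / 2 ≤ 40 * (fareyFinset N).card / (N : ℝ) ^ 2 := by linarith
  rw [le_div_iff₀ (by positivity)] at h4
  linarith

lemma sum_measureReal_ball_inter_ball_le {M N : ℕ} (hM : 0 < M) (hN : 0 < N) {ρ σ : ℝ}
    (hσ : 0 ≤ σ) (hσρ : σ ≤ ρ) :
    ∑ x ∈ fareyFinset M, ∑ y ∈ fareyFinset N,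
        volume.real (Metric.ball (x : ℝ) ρ ∩ Metric.ball (y : ℝ) σ) ≤
      10 * ((M : ℝ) ^ 2 * σ) + 40 * (((M : ℝ) ^ 2 * ρ) * ((N : ℝ) ^ 2 * σ)) := by
  have hinner : ∀ x : ℚ, ∑ y ∈ fareyFinset N,
      volume.real (Metric.ball (x : ℝ) ρ ∩ Metric.ball (y : ℝ) σ) ≤
        (1 + 4 * ρ * (N : ℝ) ^ 2) * (2 * σ) := by
    intro x
    calc ∑ y ∈ fareyFinset N, volume.real (Metric.ball (x : ℝ) ρ ∩ Metric.ball (y : ℝ) σ)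
        ≤ ∑ y ∈ fareyFinset N, if |(x : ℝ) - y| < 2 * ρ then 2 * σ else 0 :=
          Finset.sum_le_sum fun y _ => ?_
      _ = ((fareyFinset N).filter fun y : ℚ => |(x : ℝ) - y| < 2 * ρ).card * (2 * σ) := by
          rw [← Finset.sum_filter, Finset.sum_const, nsmul_eq_mul]
      _ ≤ (1 + 4 * ρ * (N : ℝ) ^ 2) * (2 * σ) := by
          have := card_fareyFinset_filter_abs_sub_lt_le hN (x : ℝ) (ρ := 2 * ρ) (by linarith)
          gcongr
          linarith
    split_ifs with h
    · rw [← Real.volume_real_ball (a := (y : ℝ)) hσ]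
      exact measureReal_mono Set.inter_subset_right measure_ball_lt_top.ne
    · have : Disjoint (Metric.ball (x : ℝ) ρ) (Metric.ball (y : ℝ) σ) :=
        Metric.ball_disjoint_ball (by rw [Real.dist_eq]; linarith)
      rw [this.inter_eq]
      simp
  calc _ ≤ ∑ x ∈ fareyFinset M, (1 + 4 * ρ * (N : ℝ) ^ 2) * (2 * σ) :=
        Finset.sum_le_sum fun x _ => hinner x
    _ = (fareyFinset M).card * ((1 + 4 * ρ * (N : ℝ) ^ 2) * (2 * σ)) := by
        rw [Finset.sum_const, nsmul_eq_mul]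
    _ ≤ 5 * (M : ℝ) ^ 2 * ((1 + 4 * ρ * (N : ℝ) ^ 2) * (2 * σ)) := by
        have : 0 ≤ ρ := hσ.trans hσρ
        gcongr
        exact card_fareyFinset_le hM
    _ = _ := by ring

lemma sum_ite_le_four_pow_mul_le (W : Finset ℕ) {r : ℕ → ℝ} (hr : ∀ k, 0 ≤ r k) :
    ∑ l ∈ W, ∑ k ∈ W, (if k ≤ l then (4 : ℝ) ^ k * r l else 0) ≤
      2 * ∑ l ∈ W, (4 : ℝ) ^ l * r l := by
  rw [Finset.mul_sum]
  refine Finset.sum_le_sum fun l _ => ?_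
  rw [← Finset.sum_filter, ← Finset.sum_mul, ← mul_assoc]
  refine mul_le_mul_of_nonneg_right ?_ (hr l)
  calc ∑ k ∈ W.filter (· ≤ l), (4 : ℝ) ^ k ≤ ∑ k ∈ Finset.range (l + 1), (4 : ℝ) ^ k :=
        Finset.sum_le_sum_of_subset_of_nonneg
          (fun k hk => Finset.mem_range_succ_iff.2 (Finset.mem_filter.1 hk).2)
          fun _ _ _ => by positivity
    _ = ((4 : ℝ) ^ (l + 1) - 1) / (4 - 1) := geom_sum_eq (by norm_num) _
    _ ≤ 2 * 4 ^ l := by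
        have : (0 : ℝ) < 4 ^ l := by positivity
        rw [pow_succ]
        linarith

lemma cast_two_pow_sq (k : ℕ) : (((2 ^ k : ℕ) : ℝ)) ^ 2 = 4 ^ k := by
  rw [Nat.cast_pow, ← pow_mul, mul_comm, pow_mul]
  norm_num

/-- The balls of radius `r k` around the rationals of denominator at most `2 ^ k`. -/
def fareyBalls (r : ℕ → ℝ) (k : ℕ) : Set ℝ := ⋃ x ∈ fareyFinset (2 ^ k), Metric.ball (x : ℝ) (r k)

lemma le_measureReal_biUnion_fareyBalls (W : Finset ℕ) {r : ℕ → ℝ} (hr : ∀ k, 0 ≤ r k)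
    (hanti : Antitone r) (hW : 1 ≤ ∑ k ∈ W, (4 : ℝ) ^ k * r k) :
    1 / 128000 ≤ volume.real (⋃ k ∈ W, fareyBalls r k) := by
  set S := ∑ k ∈ W, (4 : ℝ) ^ k * r k with hS
  have hpos : ∀ k : ℕ, 0 < 2 ^ k := fun k => by positivity
  have key := two_mul_sum_measureReal_le (μ := volume) (W.sigma fun k => fareyFinset (2 ^ k))
    (B := fun i : (_ : ℕ) × ℚ => Metric.ball (i.2 : ℝ) (r i.1))
    (fun _ => measurableSet_ball) (fun _ => measure_ball_lt_top.ne) (3200 * S)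
  have hunion : (⋃ i ∈ W.sigma fun k => fareyFinset (2 ^ k),
      Metric.ball ((i.2 : ℚ) : ℝ) (r i.1)) = ⋃ k ∈ W, fareyBalls r k := by
    ext ξ
    simp only [fareyBalls, Set.mem_iUnion, Finset.mem_sigma, Sigma.exists, exists_prop]
    tauto
  have hfirst : S / 40 ≤ ∑ i ∈ W.sigma fun k => fareyFinset (2 ^ k),
      volume.real (Metric.ball ((i.2 : ℚ) : ℝ) (r i.1)) := by
    rw [Finset.sum_sigma, hS, Finset.sum_div]
    refine Finset.sum_le_sum fun k _ => ?_
    simp only [Real.volume_real_ball (hr k), Finset.sum_const, nsmul_eq_mul]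
    have := mul_le_mul_of_nonneg_right (le_card_fareyFinset (hpos k)) (hr k)
    rw [cast_two_pow_sq] at this
    linarith
  have hpair : ∀ k l, ∑ x ∈ fareyFinset (2 ^ k), ∑ y ∈ fareyFinset (2 ^ l),
      volume.real (Metric.ball (x : ℝ) (r k) ∩ Metric.ball (y : ℝ) (r l)) ≤
        10 * (if k ≤ l then (4 : ℝ) ^ k * r l else 0) +
        10 * (if l ≤ k then (4 : ℝ) ^ l * r k else 0) +
        40 * (((4 : ℝ) ^ k * r k) * ((4 : ℝ) ^ l * r l)) := by
    intro k l
    rcases le_total k l with h | h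
    · have h1 := sum_measureReal_ball_inter_ball_le (hpos k) (hpos l) (hr l) (hanti h)
      have h2 : (0 : ℝ) ≤ if l ≤ k then (4 : ℝ) ^ l * r k else 0 := by
        have := hr k
        positivity
      simp only [cast_two_pow_sq] at h1
      rw [if_pos h]
      linarith
    · have h1 := sum_measureReal_ball_inter_ball_le (hpos l) (hpos k) (hr k) (hanti h)
      have h2 : (0 : ℝ) ≤ if k ≤ l then (4 : ℝ) ^ k * r l else 0 := by
        have := hr l
        positivity
      simp only [cast_two_pow_sq] at h1
      rw [if_pos h, Finset.sum_comm]
      simp only [Set.inter_comm (Metric.ball ((_ : ℚ) : ℝ) (r k))]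
      linarith
  have hsecond : ∑ i ∈ W.sigma fun k => fareyFinset (2 ^ k),
      ∑ j ∈ W.sigma fun k => fareyFinset (2 ^ k),
        volume.real (Metric.ball ((i.2 : ℚ) : ℝ) (r i.1) ∩
          Metric.ball ((j.2 : ℚ) : ℝ) (r j.1)) ≤ 40 * S + 40 * S ^ 2 := by
    simp only [Finset.sum_sigma]
    calc _ = ∑ k ∈ W, ∑ l ∈ W, ∑ x ∈ fareyFinset (2 ^ k), ∑ y ∈ fareyFinset (2 ^ l),
          volume.real (Metric.ball (x : ℝ) (r k) ∩ Metric.ball (y : ℝ) (r l)) :=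
          Finset.sum_congr rfl fun k _ => Finset.sum_comm
      _ ≤ _ := Finset.sum_le_sum fun k _ => Finset.sum_le_sum fun l _ => hpair k l
      _ = 10 * (∑ k ∈ W, ∑ l ∈ W, if k ≤ l then (4 : ℝ) ^ k * r l else 0) +
          10 * (∑ k ∈ W, ∑ l ∈ W, if l ≤ k then (4 : ℝ) ^ l * r k else 0) + 40 * S ^ 2 := by
          simp only [Finset.sum_add_distrib, ← Finset.mul_sum, hS, sq, Finset.sum_mul_sum]
      _ ≤ 40 * S + 40 * S ^ 2 := by
          have := sum_ite_le_four_pow_mul_le W hr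
          rw [Finset.sum_comm (f := fun k l => if k ≤ l then (4 : ℝ) ^ k * r l else 0)]
          linarith
  rw [hunion] at key
  have h1 := mul_le_mul_of_nonneg_left hfirst (by linarith : 0 ≤ 2 * (3200 * S))
  set V := volume.real (⋃ k ∈ W, fareyBalls r k)
  have h2 : 80 * S ^ 2 ≤ (3200 * S) ^ 2 * V := by nlinarith
  have h3 : S ^ 2 * 80 ≤ S ^ 2 * (3200 ^ 2 * V) := by linarith
  have h4 := le_of_mul_le_mul_left h3 (by positivity)
  linarith

lemma fareyBalls_subset {r : ℕ → ℝ} (hanti : Antitone r) (k : ℕ) :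
    fareyBalls r k ⊆ Metric.ball 0 (2 + r 0) := by
  refine Set.iUnion₂_subset fun x hx => Metric.ball_subset_ball' ?_
  have h1 := abs_le.2 (fareyFinset_bounds hx)
  have h2 := hanti (Nat.zero_le k)
  rw [Real.dist_eq, sub_zero]
  linarith

lemma measure_limsup_fareyBalls_pos {r : ℕ → ℝ} (hr : ∀ k, 0 ≤ r k) (hanti : Antitone r)
    (hdiv : ¬ Summable fun k => (4 : ℝ) ^ k * r k) :
    0 < volume (⋂ m, ⋃ k ≥ m, fareyBalls r k) := by
  have hnonneg : ∀ k, 0 ≤ (4 : ℝ) ^ k * r k := fun k => mul_nonneg (by positivity) (hr k)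
  have hfin : ∀ m, volume (⋃ k ≥ m, fareyBalls r k) ≠ ⊤ := fun m =>
    measure_ne_top_of_subset (Set.iUnion₂_subset fun k _ => fareyBalls_subset hanti k)
      measure_ball_lt_top.ne
  have htail : ∀ m, ENNReal.ofReal (1 / 128000) ≤ volume (⋃ k ≥ m, fareyBalls r k) := by
    intro m
    obtain ⟨n, hn, hmn⟩ := (((not_summable_iff_tendsto_nat_atTop_of_nonneg hnonneg).1 hdiv
      |>.eventually_ge_atTop (∑ k ∈ Finset.range m, (4 : ℝ) ^ k * r k + 1)).and
        (Filter.eventually_ge_atTop m)).exists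
    have hW : 1 ≤ ∑ k ∈ Finset.Ico m n, (4 : ℝ) ^ k * r k := by
      rw [Finset.sum_Ico_eq_sub _ hmn]
      linarith
    rw [ENNReal.ofReal_le_iff_le_toReal (hfin m)]
    refine (le_measureReal_biUnion_fareyBalls _ hr hanti hW).trans
      (measureReal_mono (Set.iUnion₂_mono' fun k hk => ⟨k, (Finset.mem_Ico.1 hk).1, le_rfl⟩)
        (hfin m))
  have hopen : ∀ m, IsOpen (⋃ k ≥ m, fareyBalls r k) := fun m =>
    isOpen_biUnion fun k _ => isOpen_biUnion fun x _ => Metric.isOpen_ball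
  have hlim := tendsto_measure_iInter_atTop (μ := volume) (s := fun m => ⋃ k ≥ m, fareyBalls r k)
    (fun m => (hopen m).measurableSet.nullMeasurableSet)
    (fun m n h => Set.iUnion₂_mono' fun k hk => ⟨k, le_trans h hk, le_rfl⟩) ⟨0, hfin 0⟩
  exact (ENNReal.ofReal_pos.2 (by norm_num)).trans_le (ge_of_tendsto' hlim htail)

lemma UnitAddCircle.ae_of_ae_coe {P : UnitAddCircle → Prop} (h : ∀ᵐ x, P x) :
    ∀ᵐ ξ : ℝ, P (ξ : UnitAddCircle) := by
  have hcover : (⋃ n : ℤ, Set.Ioc (n : ℝ) (n + 1)) = Set.univ := iUnion_Ioc_intCast ℝ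
  rw [← Measure.restrict_univ (μ := (volume : Measure ℝ)), ← hcover, ae_restrict_iUnion_iff]
  exact fun n => (UnitAddCircle.measurePreserving_mk (n : ℝ)).quasiMeasurePreserving.ae h

lemma UnitAddCircle.norm_coe_le_abs (ξ : ℝ) : ‖(ξ : UnitAddCircle)‖ ≤ |ξ| :=
  QuotientAddGroup.norm_mk_le_norm

lemma coe_mem_addWellApproximable_of_mem_fareyBalls {r δ : ℕ → ℝ}
    (hrδ : ∀ k n, 0 < n → n ≤ 2 ^ k → r k ≤ δ n) (hr : Filter.Tendsto r Filter.atTop (nhds 0))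
    {ξ : ℝ} (hirr : Irrational ξ) (hξ : ξ ∈ ⋂ m, ⋃ k ≥ m, fareyBalls r k) :
    (ξ : UnitAddCircle) ∈ addWellApproximable UnitAddCircle δ := by
  rw [mem_add_wellApproximable_iff, ← Nat.cofinite_eq_atTop, Filter.cofinite.blimsup_set_eq]
  intro hfin
  obtain ⟨M, hM⟩ := hfin.bddAbove
  have hev : ∀ᶠ k in Filter.atTop, ∀ x ∈ fareyFinset M, r k < |ξ - x| :=
    (Filter.eventually_all_finset _).2 fun x _ =>
      hr.eventually_lt_const (abs_pos.2 (sub_ne_zero.2 (hirr.ne_rat x)))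
  obtain ⟨m, hm⟩ := Filter.eventually_atTop.1 hev
  obtain ⟨k, hk, hmem⟩ := Set.mem_iUnion₂.1 (Set.mem_iInter.1 hξ m)
  obtain ⟨x, hx, hball⟩ := Set.mem_iUnion₂.1 hmem
  rw [Metric.mem_ball, Real.dist_eq] at hball
  have hxM : x.den ≤ M := by
    refine hM ⟨x.pos, mem_approx_add_orderOf_iff.2 ⟨((x : ℝ) : UnitAddCircle), ?_, ?_⟩⟩
    · simpa using AddCircle.addOrderOf_coe_rat (p := (1 : ℝ)) (q := x)
    · rw [Metric.mem_ball, dist_eq_norm, ← AddCircle.coe_sub]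
      exact ((UnitAddCircle.norm_coe_le_abs _).trans_lt hball).trans_le
        (hrδ k _ x.pos (mem_fareyFinset.1 hx).1)
  exact hball.not_gt (hm k hk x (mem_fareyFinset.2 ⟨hxM, (mem_fareyFinset.1 hx).2⟩))

lemma ae_mem_addWellApproximable_of_not_summable {r δ : ℕ → ℝ} (hr : ∀ k, 0 ≤ r k)
    (hanti : Antitone r) (hr0 : Filter.Tendsto r Filter.atTop (nhds 0))
    (hdiv : ¬ Summable fun k => (4 : ℝ) ^ k * r k) (hδ : Filter.Tendsto δ Filter.atTop (nhds 0))
    (hrδ : ∀ k n, 0 < n → n ≤ 2 ^ k → r k ≤ δ n) :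
    ∀ᵐ x, x ∈ addWellApproximable UnitAddCircle δ := by
  refine (AddCircle.addWellApproximable_ae_empty_or_univ (T := 1) δ hδ).resolve_left fun h => ?_
  have hnull : ∀ᵐ ξ : ℝ, ξ ∉ ⋂ m, ⋃ k ≥ m, fareyBalls r k := by
    filter_upwards [UnitAddCircle.ae_of_ae_coe h,
      (Set.countable_range ((↑) : ℚ → ℝ)).ae_notMem volume] with ξ h1 h2 h3
    exact h1 (coe_mem_addWellApproximable_of_mem_fareyBalls hrδ hr0 h2 h3)
  exact (measure_limsup_fareyBalls_pos hr hanti hdiv).ne' (measure_eq_zero_iff_ae_notMem.2 hnull)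

lemma infinite_of_coe_mem_addWellApproximable {ψ : ℝ → ℝ} {ξ : ℝ}
    (h : (ξ : UnitAddCircle) ∈ addWellApproximable UnitAddCircle fun n => ψ n / n) :
    {pq : ℤ × ℤ | 0 < pq.2 ∧ |(pq.2 : ℝ) * ξ - (pq.1 : ℝ)| < ψ (pq.2 : ℝ)}.Infinite := by
  rw [UnitAddCircle.mem_addWellApproximable_iff] at h
  refine Set.Infinite.of_image (fun pq : ℤ × ℤ => pq.2.toNat) (h.mono ?_)
  rintro n ⟨m, hmn, -, hlt⟩
  have hn : (0 : ℝ) < n := by exact_mod_cast pos_of_gt hmn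
  rw [← AddCircle.coe_sub, UnitAddCircle.norm_eq, lt_div_iff₀ hn] at hlt
  refine ⟨(m + n * round (ξ - (m : ℝ) / n), n), ⟨Nat.cast_pos.2 (pos_of_gt hmn), ?_⟩, by simp⟩
  push_cast
  refine lt_of_eq_of_lt ?_ hlt
  nth_rewrite 6 [← abs_of_pos hn]
  rw [← abs_mul]
  congr 1
  field_simp
  ring

lemma finite_of_finite_norm_nsmul_lt {ψ : ℝ → ℝ} {ξ : ℝ}
    (h : {n : ℕ | ‖(n + 1) • (ξ : UnitAddCircle)‖ < ψ (n + 1)}.Finite) :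
    {pq : ℤ × ℤ | 0 < pq.2 ∧ |(pq.2 : ℝ) * ξ - (pq.1 : ℝ)| < ψ (pq.2 : ℝ)}.Finite := by
  refine (h.biUnion fun n _ => ((Set.finite_Icc ⌊(n + 1) * ξ - ψ (n + 1)⌋
    ⌈(n + 1) * ξ + ψ (n + 1)⌉).prod (Set.finite_singleton (n + 1 : ℤ)))).subset ?_
  rintro ⟨p, q⟩ ⟨hq, hlt⟩
  obtain ⟨n, rfl⟩ : ∃ n : ℕ, q = n + 1 := ⟨(q - 1).toNat, by simp only at hq; omega⟩
  push_cast at hlt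
  refine Set.mem_biUnion (x := n) ?_ ⟨?_, rfl⟩
  · have h1 : (n + 1) • (ξ : UnitAddCircle) = (((n + 1) * ξ - p : ℝ) : UnitAddCircle) := by
      have h2 : ((p : ℝ) : UnitAddCircle) = 0 :=
        (AddCircle.coe_eq_zero_iff 1).2 ⟨p, by simp⟩
      rw [AddCircle.coe_sub, h2, sub_zero, ← AddCircle.coe_nsmul, nsmul_eq_mul]
      push_cast
      rfl
    rw [Set.mem_ofPred_eq, h1]
    exact (UnitAddCircle.norm_coe_le_abs _).trans_lt hlt
  · have := abs_lt.1 hlt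
    constructor
    · exact Int.cast_le.1 ((Int.floor_le _).trans (by linarith : _ ≤ (p : ℝ)))
    · exact Int.cast_le.1 ((by linarith : (p : ℝ) ≤ _).trans (Int.le_ceil _))

lemma UnitAddCircle.ae_finite_norm_nsmul_lt {a : ℕ → ℝ} (ha : Summable a) :
    ∀ᵐ x : UnitAddCircle, {n : ℕ | ‖(n + 1) • x‖ < a n}.Finite := by
  refine ae_finite_setOfPred_mem (s := fun n => {x : UnitAddCircle | ‖(n + 1) • x‖ < a n})
    (ne_top_of_le_ne_top (ha.mul_left 2).tsum_ofReal_ne_top (ENNReal.tsum_le_tsum fun n => ?_))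
  have hmp : MeasurePreserving (fun x : UnitAddCircle => ((n + 1 : ℕ) : ℤ) • x) :=
    MeasureTheory.Measure.measurePreserving_zsmul volume (by positivity)
  have hset : {x : UnitAddCircle | ‖(n + 1) • x‖ < a n} =
      (fun x : UnitAddCircle => ((n + 1 : ℕ) : ℤ) • x) ⁻¹' Metric.ball 0 (a n) := by
    ext x
    simp only [Set.mem_ofPred_eq, Set.mem_preimage, mem_ball_zero_iff, natCast_zsmul]
  rw [hset, hmp.measure_preimage measurableSet_ball.nullMeasurableSet]
  refine (measure_mono Metric.ball_subset_closedBall).trans ?_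
  rw [AddCircle.volume_closedBall]
  exact ENNReal.ofReal_le_ofReal (min_le_right _ _)

/-- Khintchine's theorem (convergence and divergence cases). -/
theorem khintchine_theorem (Ψ : ℝ → ℝ) (hpos : ∀ x : ℝ, 1 ≤ x → 0 < Ψ x)
    (hmono : ∀ x y : ℝ, 1 ≤ x → x ≤ y → Ψ y ≤ Ψ x) :
    (Summable (fun n : ℕ => Ψ (n + 1)) →
      ∀ᵐ ξ ∂(volume : Measure ℝ),
        {pq : ℤ × ℤ | 0 < pq.2 ∧ |(pq.2 : ℝ) * ξ - (pq.1 : ℝ)| < Ψ (pq.2 : ℝ)}.Finite) ∧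
    (¬ Summable (fun n : ℕ => Ψ (n + 1)) →
      ∀ᵐ ξ ∂(volume : Measure ℝ),
        {pq : ℤ × ℤ | 0 < pq.2 ∧ |(pq.2 : ℝ) * ξ - (pq.1 : ℝ)| < Ψ (pq.2 : ℝ)}.Infinite) := by
  refine ⟨fun hsum => ?_, fun hdiv => ?_⟩
  · filter_upwards [UnitAddCircle.ae_of_ae_coe
      (UnitAddCircle.ae_finite_norm_nsmul_lt hsum)] with ξ hξ
    exact finite_of_finite_norm_nsmul_lt hξ
  · have hcast : ∀ {n : ℕ}, 0 < n → (1 : ℝ) ≤ n := fun h => by exact_mod_cast h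
    have hpow : ∀ k : ℕ, (1 : ℝ) ≤ 2 ^ k := fun k => one_le_pow₀ (by norm_num)
    have hδ : Filter.Tendsto (fun n : ℕ => Ψ n / n) Filter.atTop (nhds 0) := by
      refine squeeze_zero' ?_ ?_ (tendsto_const_div_atTop_nhds_zero_nat (Ψ 1))
      · filter_upwards [Filter.eventually_gt_atTop 0] with n hn
        exact div_nonneg (hpos _ (hcast hn)).le n.cast_nonneg
      · filter_upwards [Filter.eventually_gt_atTop 0] with n hn
        have := hmono 1 n le_rfl (hcast hn)
        gcongr
    have hquot : ∀ x y : ℝ, 1 ≤ x → x ≤ y → Ψ y / y ≤ Ψ x / x := fun x y hx hxy =>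
      div_le_div₀ (hpos x hx).le (hmono x y hx hxy) (by linarith) hxy
    have hcond : ¬ Summable fun k : ℕ => (4 : ℝ) ^ k * (Ψ (2 ^ k) / 2 ^ k) := by
      intro h
      refine hdiv ?_
      let f : ℕ → ℝ := fun n => if n = 0 then Ψ 1 else Ψ n
      have hf : Summable f := by
        rw [← summable_condensed_iff_of_nonneg (f := f)]
        · refine h.congr fun k => ?_
          have h4 : (4 : ℝ) ^ k = 2 ^ k * 2 ^ k := by rw [← mul_pow]; norm_num
          simp only [f, Nat.pow_eq_zero, OfNat.ofNat_ne_zero, false_and, if_false, Nat.cast_pow,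
            Nat.cast_ofNat, h4]
          field_simp
        · intro n
          by_cases hn : n = 0
          · simpa [f, hn] using (hpos 1 le_rfl).le
          · simpa [f, hn] using (hpos n (hcast (Nat.pos_of_ne_zero hn))).le
        · intro m n hm hmn
          simp only [f, hm.ne', (hm.trans_le hmn).ne', if_false]
          exact hmono _ _ (hcast hm) (by exact_mod_cast hmn)
      simpa [f] using (summable_nat_add_iff 1).2 hf
    filter_upwards [UnitAddCircle.ae_of_ae_coe (ae_mem_addWellApproximable_of_not_summable
      (r := fun k => Ψ (2 ^ k) / 2 ^ k) (δ := fun n => Ψ n / n)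
      (fun k => div_nonneg (hpos _ (hpow k)).le (by positivity))
      (fun k l hkl => hquot _ _ (hpow k) (pow_le_pow_right₀ (by norm_num) hkl))
      (by simpa [Function.comp_def] using
        hδ.comp (tendsto_pow_atTop_atTop_of_one_lt (one_lt_two : 1 < 2)))
      hcond hδ
      fun k n hn hnk => hquot _ _ (hcast hn) (by exact_mod_cast hnk))] with ξ hξ
    exact infinite_of_coe_mem_addWellApproximable hξ
end

section
/- Davenport–Schmidt criterion: Let ξ be a real number and n ≥ 2 an integer. Assume that for each sufficiently large positive integer N there exists a nonzero polynomial P_N ∈ ℤ[X] of degree ≤ n and height ≤ N such that |P_N(ξ)| ≤ N^{−2n+1}. Then ξ is algebraic of degree ≤ n. -/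
/-- The (usual) height of an integer polynomial: the maximum of the absolute
values of its coefficients. -/
noncomputable def intPolyHeight (f : Polynomial ℤ) : ℕ :=
  (Finset.range (f.natDegree + 1)).sup fun i => (f.coeff i).natAbs

namespace DavenportSchmidt

open Polynomial

/-- The Mahler measure of an integer polynomial. -/
noncomputable def intMahler (p : ℤ[X]) : ℝ := (p.map (Int.castRingHom ℂ)).mahlerMeasure

lemma one_le_intMahler {p : ℤ[X]} (hp : p ≠ 0) : 1 ≤ intMahler p :=
  one_le_mahlerMeasure_of_ne_zero hp

lemma intMahler_mul (p q : ℤ[X]) : intMahler (p * q) = intMahler p * intMahler q := by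
  simp [intMahler, Polynomial.map_mul, mahlerMeasure_mul]

lemma intMahler_neg (p : ℤ[X]) : intMahler (-p) = intMahler p := by
  have h : -p = C (-1) * p := by simp
  rw [h, intMahler_mul]
  have h1 : (C (-1 : ℤ)).map (Int.castRingHom ℂ) = C (-1 : ℂ) := by simp
  rw [intMahler, h1, mahlerMeasure_const]
  simp

lemma abs_coeff_le_intMahler {n : ℕ} {p : ℤ[X]} (hp : p.natDegree ≤ n) (i : ℕ) :
    |(p.coeff i : ℝ)| ≤ 2 ^ n * intMahler p := by
  have h := norm_coeff_le_choose_mul_mahlerMeasure i (p.map (Int.castRingHom ℂ))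
  have h0 : 0 ≤ intMahler p := mahlerMeasure_nonneg _
  have hc : ((p.map (Int.castRingHom ℂ)).natDegree.choose i : ℝ) ≤ 2 ^ n := by
    have : (p.map (Int.castRingHom ℂ)).natDegree.choose i ≤ 2 ^ n :=
      (Nat.choose_le_two_pow _ _).trans
        (Nat.pow_le_pow_right two_pos ((natDegree_map_le).trans hp))
    exact_mod_cast this
  have h1 : ‖(p.map (Int.castRingHom ℂ)).coeff i‖ = |(p.coeff i : ℝ)| := by
    simp [coeff_map]
  rw [h1] at h
  exact h.trans (mul_le_mul_of_nonneg_right hc h0)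

lemma abs_coeff_le_height (p : ℤ[X]) (i : ℕ) : (p.coeff i).natAbs ≤ intPolyHeight p := by
  by_cases hi : i ∈ Finset.range (p.natDegree + 1)
  · exact Finset.le_sup (f := fun i => (p.coeff i).natAbs) hi
  · have : p.coeff i = 0 := coeff_eq_zero_of_natDegree_lt (by simpa using hi)
    simp [this]

lemma intMahler_le_height {n N : ℕ} {p : ℤ[X]} (hp : p.natDegree ≤ n)
    (hN : intPolyHeight p ≤ N) : intMahler p ≤ (n + 1) * N := by
  refine (mahlerMeasure_le_sum_norm_coeff _).trans ?_
  rw [sum_over_range' _ (by simp) (n + 1) (Nat.lt_succ_of_le (natDegree_map_le.trans hp))]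
  refine (Finset.sum_le_card_nsmul _ _ (N : ℝ) fun i _ => ?_).trans (by simp)
  have h : ‖(p.map (Int.castRingHom ℂ)).coeff i‖ = ((p.coeff i).natAbs : ℝ) := by
    simp [coeff_map, Nat.cast_natAbs]
  rw [h]
  exact_mod_cast (abs_coeff_le_height p i).trans hN

lemma exists_injective_det_ne_zero {d : ℕ} {ι : Type} (v : ι → Fin d → ℚ)
    (hv : Submodule.span ℚ (Set.range v) = ⊤) :
    ∃ e : Fin d → ι, Function.Injective e ∧ (Matrix.of (v ∘ e)).det ≠ 0 := by
  obtain ⟨κ, a, ha, hs, hli⟩ := exists_linearIndependent' (K := ℚ) v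
  rw [hv] at hs
  let b := Module.Basis.mk hli hs.ge
  have : Finite κ := Module.Finite.finite_basis b
  have := Fintype.ofFinite κ
  have hc : Fintype.card κ = d := by
    rw [← Module.finrank_eq_card_basis b]; simp
  let s : Fin d ≃ κ := (Fintype.equivFinOfCardEq hc).symm
  refine ⟨a ∘ s, ha.comp s.injective, ?_⟩
  have hli' : LinearIndependent ℚ (Matrix.of (v ∘ a ∘ s)).row :=
    hli.comp s s.injective
  have := Matrix.linearIndependent_rows_iff_isUnit.1 hli'
  exact ((Matrix.isUnit_iff_isUnit_det _).1 this).ne_zero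

lemma one_le_of_span {d : ℕ} (hd : 0 < d) {ι : Type} (g : ι → ℤ[X])
    (hg : ∀ i, (g i).natDegree < d) (ξ δ : ℝ) (H : ι → ℝ)
    (hH : ∀ i j, |((g i).coeff j : ℝ)| ≤ H i) (hδ : ∀ i, |aeval ξ (g i)| ≤ δ * H i)
    (hspan : ∀ f : ℚ[X], f.degree < d →
      f ∈ Submodule.span ℚ (Set.range fun i => (g i).map (Int.castRingHom ℚ))) :
    ∃ e : Fin d → ι, Function.Injective e ∧ 1 ≤ d.factorial * (δ * ∏ i, H (e i)) := by
  obtain ⟨e, he, hdet⟩ := exists_injective_det_ne_zero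
    (fun i => toFn d ((g i).map (Int.castRingHom ℚ))) (by
      rw [eq_top_iff]
      intro x _
      have h1 := Submodule.mem_map_of_mem (f := toFn d)
        (hspan (ofFn d x) (ofFn_degree_lt x))
      rw [Submodule.map_span, ← Set.range_comp, toFn_comp_ofFn_eq_id] at h1
      exact h1)
  refine ⟨e, he, ?_⟩
  let A : Matrix (Fin d) (Fin d) ℤ := Matrix.of fun i j => (g (e i)).coeff j
  have hA : A.det ≠ 0 := by
    intro h0
    apply hdet
    have h2 : (A.map (Int.castRingHom ℚ)).det = 0 := by
      rw [← RingHom.mapMatrix_apply, ← RingHom.map_det, h0, map_zero]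
    rw [← h2]
    congr 1
    ext i j
    simp [A, toFn]
  let B : Matrix (Fin d) (Fin d) ℝ := A.map (Int.castRingHom ℝ)
  have hB : 1 ≤ |B.det| := by
    have : B.det = (A.det : ℝ) := by
      simp only [B]
      rw [← RingHom.mapMatrix_apply, ← RingHom.map_det]; simp
    rw [this]
    exact_mod_cast Int.one_le_abs hA
  let z : Fin d := ⟨0, hd⟩
  have hcol := B.det_updateCol_sum z (fun i => ξ ^ (i : ℕ))
  have hz : ξ ^ (z : ℕ) = 1 := by simp [z]
  rw [hz, one_smul] at hcol
  rw [← hcol] at hB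
  have hsum : ∀ k, ∑ i : Fin d, ξ ^ (i : ℕ) • B k i = aeval ξ (g (e k)) := by
    intro k
    rw [aeval_eq_sum_range' (hg (e k)), ← Fin.sum_univ_eq_sum_range
      (fun i => (g (e k)).coeff i • ξ ^ i)]
    refine Finset.sum_congr rfl fun i _ => ?_
    simp [B, A, mul_comm]
  simp only [hsum] at hB
  refine hB.trans ?_
  rw [Matrix.det_apply]
  refine (Finset.abs_sum_le_sum_abs _ _).trans ?_
  refine (Finset.sum_le_card_nsmul _ _ (δ * ∏ i, H (e i)) fun σ _ => ?_).trans
    (by simp [Fintype.card_perm])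
  have hs : ∀ x : ℝ, |Equiv.Perm.sign σ • x| = |x| := by
    intro x
    rcases Int.units_eq_one_or (Equiv.Perm.sign σ) with h | h <;> simp [h]
  rw [hs, Finset.abs_prod]
  have hw : ∏ i : Fin d, ((if i = z then δ else 1) * H (e (σ i))) = δ * ∏ i, H (e i) := by
    rw [Finset.prod_mul_distrib, Equiv.prod_comp σ (fun i => H (e i))]
    simp
  rw [← hw]
  refine Finset.prod_le_prod (fun _ _ => abs_nonneg _) fun i _ => ?_
  by_cases hi : i = z
  · subst hi
    simpa using hδ (e (σ z))
  · simpa [hi, B, A] using hH (e (σ i)) i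

lemma mul_mem_of_X_pow_mul_mem {V : Submodule ℚ ℚ[X]} {P s : ℚ[X]} {m : ℕ} (hs : s.degree < m)
    (h : ∀ a < m, X ^ a * P ∈ V) : s * P ∈ V := by
  rw [s.as_sum_range_C_mul_X_pow, Finset.sum_mul]
  refine Submodule.sum_mem _ fun i _ => ?_
  by_cases hi : i < m
  · rw [mul_assoc, ← smul_eq_C_mul]
    exact V.smul_mem _ (h i hi)
  · have : s.coeff i = 0 :=
      coeff_eq_zero_of_degree_lt (hs.trans_le (by exact_mod_cast not_lt.1 hi))
    simp [this]

lemma exists_mul_add_mul_eq_of_isCoprime {P Q f : ℚ[X]} (hPQ : IsCoprime P Q) (hQ : Q ≠ 0)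
    (hf : f.degree < (P.natDegree + Q.natDegree : ℕ)) :
    ∃ s t : ℚ[X], s.degree < Q.natDegree ∧ t.degree < P.natDegree ∧ f = s * P + t * Q := by
  obtain ⟨u, v, huv⟩ := hPQ
  let s := (f * u) % Q
  let t := f * v + ((f * u) / Q) * P
  have hst : f = s * P + t * Q := by
    have h := EuclideanDomain.div_add_mod (f * u) Q
    have : s = f * u - Q * (f * u / Q) := eq_sub_of_add_eq' h
    simp only [t]; rw [this]
    linear_combination (-f) * huv
  have hs : s.degree < Q.natDegree := by
    rw [← degree_eq_natDegree hQ]; exact EuclideanDomain.mod_lt _ hQ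
  refine ⟨s, t, hs, ?_, hst⟩
  by_contra! ht
  have ht0 : t ≠ 0 := by
    rintro h
    rw [h, degree_zero] at ht
    simp at ht
  have h1 : (t * Q).degree = t.degree + Q.natDegree := by
    rw [degree_mul, degree_eq_natDegree hQ]
  have h2 : t * Q = f - s * P := by rw [hst]; ring
  have h3 : (f - s * P).degree < (P.natDegree + Q.natDegree : ℕ) := by
    refine (degree_sub_le _ _).trans_lt (max_lt hf ?_)
    by_cases hP : P = 0
    · rw [hP, mul_zero, degree_zero]; exact WithBot.bot_lt_coe _
    by_cases hs0 : s = 0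
    · rw [hs0, zero_mul, degree_zero]; exact WithBot.bot_lt_coe _
    rw [degree_eq_natDegree hs0] at hs
    rw [degree_mul, degree_eq_natDegree hs0, degree_eq_natDegree hP]
    have : s.natDegree < Q.natDegree := by exact_mod_cast hs
    have : s.natDegree + P.natDegree < P.natDegree + Q.natDegree := by omega
    exact_mod_cast this
  rw [← h2, h1, degree_eq_natDegree ht0] at h3
  rw [degree_eq_natDegree ht0] at ht
  have h4 : t.natDegree + Q.natDegree < P.natDegree + Q.natDegree := by exact_mod_cast h3
  have h5 : P.natDegree ≤ t.natDegree := by exact_mod_cast ht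
  omega

lemma abs_coeff_X_pow_mul_le {n : ℕ} {p : ℤ[X]} (hp : p.natDegree ≤ n) (a j : ℕ) :
    |((X ^ a * p).coeff j : ℝ)| ≤ 2 ^ n * intMahler p := by
  rw [coeff_X_pow_mul']
  split_ifs
  · exact abs_coeff_le_intMahler hp _
  · have : 0 ≤ intMahler p := mahlerMeasure_nonneg _
    simp; positivity

lemma abs_aeval_X_pow_mul_le {n a : ℕ} (ha : a ≤ n) (p : ℤ[X]) (ξ : ℝ) :
    |aeval ξ (X ^ a * p)| ≤ (1 + |ξ|) ^ n * |aeval ξ p| := by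
  rw [map_mul, abs_mul, map_pow, aeval_X, abs_pow]
  gcongr
  calc |ξ| ^ a ≤ (1 + |ξ|) ^ a := by gcongr; linarith
    _ ≤ (1 + |ξ|) ^ n := pow_le_pow_right₀ (by linarith [abs_nonneg ξ]) ha

/-- The resultant estimate for two coprime integer polynomials. -/
lemma resultant_estimate (n : ℕ) (ξ : ℝ) : ∃ c : ℝ, 1 ≤ c ∧ ∀ P Q : ℤ[X], P ≠ 0 → Q ≠ 0 →
    0 < P.natDegree → P.natDegree ≤ n → Q.natDegree ≤ n →
    IsCoprime (P.map (Int.castRingHom ℚ)) (Q.map (Int.castRingHom ℚ)) →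
    intMahler P ≤ c * (intMahler P ^ Q.natDegree * intMahler Q ^ P.natDegree * |aeval ξ P|) ∨
    intMahler Q ≤ c * (intMahler P ^ Q.natDegree * intMahler Q ^ P.natDegree * |aeval ξ Q|) := by
  have hx : 1 ≤ 1 + |ξ| := by linarith [abs_nonneg ξ]
  refine ⟨(2 * n).factorial * (1 + |ξ|) ^ n * (2 ^ n) ^ (2 * n), ?_, ?_⟩
  · have h1 : (1 : ℝ) ≤ (2 * n).factorial := by exact_mod_cast Nat.factorial_pos _
    have h2 : 1 ≤ (1 + |ξ|) ^ n := one_le_pow₀ hx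
    have h3 : (1 : ℝ) ≤ (2 ^ n) ^ (2 * n) := one_le_pow₀ (one_le_pow₀ (by norm_num))
    exact one_le_mul_of_one_le_of_one_le (one_le_mul_of_one_le_of_one_le h1 h2) h3
  intro P Q hP hQ hPd hPn hQn hPQ
  set p := P.natDegree with hp
  set q := Q.natDegree with hq
  have hMP := one_le_intMahler hP
  have hMQ := one_le_intMahler hQ
  set h := intMahler P
  set k := intMahler Q
  have hinj : Function.Injective (Int.castRingHom ℚ) := Int.cast_injective
  let g : Fin q ⊕ Fin p → ℤ[X] := Sum.elim (fun a => X ^ (a : ℕ) * P) (fun a => X ^ (a : ℕ) * Q)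
  let H : Fin q ⊕ Fin p → ℝ := Sum.elim (fun _ => 2 ^ n * h) (fun _ => 2 ^ n * k)
  let δ := (1 + |ξ|) ^ n * max (|aeval ξ P| / h) (|aeval ξ Q| / k)
  have hB : (1 : ℝ) ≤ 2 ^ n := one_le_pow₀ (by norm_num)
  have hδ0 : 0 ≤ δ := mul_nonneg (by positivity) (le_max_of_le_left (by positivity))
  obtain ⟨e, he, hmain⟩ := one_le_of_span (d := p + q) (by omega) g (by
      rintro (a | a)
      · simp only [g, Sum.elim_inl]
        rw [natDegree_X_pow_mul _ hP]; omega
      · simp only [g, Sum.elim_inr]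
        rw [natDegree_X_pow_mul _ hQ]; omega) ξ δ H (by
      rintro (a | a) j
      · exact abs_coeff_X_pow_mul_le hPn _ _
      · exact abs_coeff_X_pow_mul_le hQn _ _) (by
      rintro (a | a)
      · simp only [g, H, Sum.elim_inl]
        refine (abs_aeval_X_pow_mul_le (by omega : (a : ℕ) ≤ n) P ξ).trans ?_
        have h1 : |aeval ξ P| / h ≤ max (|aeval ξ P| / h) (|aeval ξ Q| / k) := le_max_left _ _
        rw [div_le_iff₀ (by linarith)] at h1
        calc (1 + |ξ|) ^ n * |aeval ξ P|
            ≤ (1 + |ξ|) ^ n * (max (|aeval ξ P| / h) (|aeval ξ Q| / k) * h) := by gcongr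
          _ = δ * h := by simp only [δ]; ring
          _ ≤ δ * (2 ^ n * h) := by gcongr; nlinarith
      · simp only [g, H, Sum.elim_inr]
        refine (abs_aeval_X_pow_mul_le (by omega : (a : ℕ) ≤ n) Q ξ).trans ?_
        have h1 : |aeval ξ Q| / k ≤ max (|aeval ξ P| / h) (|aeval ξ Q| / k) := le_max_right _ _
        rw [div_le_iff₀ (by linarith)] at h1
        calc (1 + |ξ|) ^ n * |aeval ξ Q|
            ≤ (1 + |ξ|) ^ n * (max (|aeval ξ P| / h) (|aeval ξ Q| / k) * k) := by gcongr
          _ = δ * k := by simp only [δ]; ring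
          _ ≤ δ * (2 ^ n * k) := by gcongr; nlinarith) (by
      intro f hf
      obtain ⟨s, t, hs, ht, rfl⟩ := exists_mul_add_mul_eq_of_isCoprime (f := f) hPQ
        ((Polynomial.map_ne_zero_iff hinj).2 hQ)
        (by rwa [natDegree_map_eq_of_injective hinj, natDegree_map_eq_of_injective hinj])
      rw [natDegree_map_eq_of_injective hinj] at hs ht
      refine Submodule.add_mem _ (mul_mem_of_X_pow_mul_mem hs fun a ha => ?_)
        (mul_mem_of_X_pow_mul_mem ht fun a ha => ?_)
      · exact Submodule.subset_span ⟨Sum.inl ⟨a, ha⟩, by simp [g]⟩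
      · exact Submodule.subset_span ⟨Sum.inr ⟨a, ha⟩, by simp [g]⟩)
  have hbij : Function.Bijective e := by
    rw [Fintype.bijective_iff_injective_and_card]
    exact ⟨he, by simp [add_comm]⟩
  have hprod : ∏ i, H (e i) = (2 ^ n) ^ (p + q) * (h ^ q * k ^ p) := by
    rw [hbij.prod_comp H, Fintype.prod_sum_type]
    simp [H, mul_pow]
    ring
  rw [hprod] at hmain
  have hfac : ((p + q).factorial : ℝ) ≤ (2 * n).factorial := by
    exact_mod_cast Nat.factorial_le (by omega)
  have hpow : ((2 : ℝ) ^ n) ^ (p + q) ≤ (2 ^ n) ^ (2 * n) := pow_le_pow_right₀ hB (by omega)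
  have hfin : 1 ≤ (2 * n).factorial * (δ * ((2 ^ n) ^ (2 * n) * (h ^ q * k ^ p))) :=
    hmain.trans (by gcongr)
  rcases max_cases (|aeval ξ P| / h) (|aeval ξ Q| / k) with ⟨h1, -⟩ | ⟨h1, -⟩
  · left
    simp only [δ, h1] at hfin
    have h0 : 0 < h := by linarith
    have := mul_le_mul_of_nonneg_left hfin h0.le
    rw [mul_one] at this
    refine this.trans_eq ?_
    field_simp
  · right
    simp only [δ, h1] at hfin
    have h0 : 0 < k := by linarith
    have := mul_le_mul_of_nonneg_left hfin h0.le
    rw [mul_one] at this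
    refine this.trans_eq ?_
    field_simp

/-- Linear independence of three rational polynomials, in coordinates. -/
def Independent₃ (P Q R : ℚ[X]) : Prop :=
  ∀ x y z : ℚ, C x * P + C y * Q + C z * R = 0 → x = 0 ∧ y = 0 ∧ z = 0

lemma eq_C_mul_of_dvd {P S : ℚ[X]} (hP : P ≠ 0) (hS : S.natDegree ≤ P.natDegree) (h : P ∣ S) :
    ∃ c : ℚ, S = C c * P := by
  obtain ⟨w, rfl⟩ := h
  by_cases hw : w = 0
  · exact ⟨0, by simp [hw]⟩
  rw [natDegree_mul hP hw] at hS
  refine ⟨w.coeff 0, ?_⟩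
  rw [← eq_C_of_natDegree_eq_zero (by omega : w.natDegree = 0), mul_comm]

lemma ker_eq_top_of_coprime {P S : ℚ[X]} {n : ℕ} (hP : P.natDegree = n) (hP0 : P ≠ 0)
    {V : Submodule ℚ ℚ[X]} (hPV : ∀ f, P * f ∈ V) (hS : ∀ a < n, X ^ a * S ∈ V)
    (hPS : IsCoprime P S) : V = ⊤ := by
  have hSV : ∀ y, y * S ∈ V := by
    intro y
    rw [← EuclideanDomain.div_add_mod y P, add_mul, mul_assoc]
    refine V.add_mem (hPV _) (mul_mem_of_X_pow_mul_mem ?_ hS)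
    rw [← hP, ← degree_eq_natDegree hP0]
    exact EuclideanDomain.mod_lt _ hP0
  obtain ⟨u, v, huv⟩ := hPS
  rw [eq_top_iff]
  intro f _
  have : f = P * (f * u) + (f * v) * S := by linear_combination (-f) * huv
  rw [this]
  exact V.add_mem (hPV _) (hSV _)

lemma span_sup_multiples_eq_top {P Q R : ℚ[X]} {n : ℕ} (hP : P.natDegree = n)
    (hPirr : Irreducible P) (hQ : Q.natDegree ≤ n) (hR : R.natDegree ≤ n)
    (hli : Independent₃ P Q R) {V : Submodule ℚ ℚ[X]} (hPV : ∀ f, P * f ∈ V)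
    (hQV : ∀ a < n - 1, X ^ a * Q ∈ V) (hRV : ∀ a < n - 1, X ^ a * R ∈ V) : V = ⊤ := by
  by_contra hV
  obtain ⟨l, hl0, hl⟩ := V.exists_le_ker_of_lt_top (lt_top_iff_ne_top.2 hV)
  have hl0' : LinearMap.ker l ≠ ⊤ := by rwa [Ne, LinearMap.ker_eq_top]
  have hP0 := hPirr.ne_zero
  have key : ∀ S : ℚ[X], S.natDegree ≤ n → (∀ a < n, X ^ a * S ∈ LinearMap.ker l) →
      ∃ c, S = C c * P := by
    intro S hS hSl
    rcases dvd_or_isCoprime P S hPirr with h | h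
    · exact eq_C_mul_of_dvd hP0 (hP ▸ hS) h
    · exact absurd (ker_eq_top_of_coprime hP hP0 (fun f => hl (hPV f)) hSl h) hl0'
  set α := l (X ^ (n - 1) * Q) with hα
  set β := l (X ^ (n - 1) * R) with hβ
  obtain ⟨c, hc⟩ := key (C β * Q - C α * R)
    ((natDegree_sub_le _ _).trans (max_le ((natDegree_C_mul_le _ _).trans hQ)
      ((natDegree_C_mul_le _ _).trans hR))) (by
    intro a ha
    have h1 : X ^ a * (C β * Q - C α * R) = β • (X ^ a * Q) - α • (X ^ a * R) := by
      simp only [smul_eq_C_mul]; ring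
    rw [LinearMap.mem_ker, h1, map_sub, map_smul, map_smul]
    by_cases h : a < n - 1
    · rw [LinearMap.mem_ker.1 (hl (hQV a h)), LinearMap.mem_ker.1 (hl (hRV a h))]; simp
    · have : a = n - 1 := by omega
      rw [this, ← hα, ← hβ, smul_eq_mul, smul_eq_mul]; ring)
  have h0 := hli c (-β) α (by rw [← hc]; simp only [C_neg]; ring)
  obtain ⟨c', hc'⟩ := key Q hQ (by
    intro a ha
    by_cases h : a < n - 1
    · exact hl (hQV a h)
    · have : a = n - 1 := by omega
      rw [LinearMap.mem_ker, this, ← hα, h0.2.2])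
  have h1 := hli c' (-1) 0 (by rw [← hc']; simp)
  norm_num at h1

lemma mem_span_of_independent {P Q R : ℚ[X]} {n : ℕ} (hn : 2 ≤ n) (hP : P.natDegree = n)
    (hPirr : Irreducible P) (hQ : Q.natDegree ≤ n) (hR : R.natDegree ≤ n)
    (hli : Independent₃ P Q R) {V : Submodule ℚ ℚ[X]} (hPV : ∀ a < n - 1, X ^ a * P ∈ V)
    (hQV : ∀ a < n - 1, X ^ a * Q ∈ V) (hRV : ∀ a < n - 1, X ^ a * R ∈ V)
    {f : ℚ[X]} (hf : f.degree < (2 * n - 1 : ℕ)) : f ∈ V := by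
  have hP0 := hPirr.ne_zero
  have hdeg : ∀ S : ℚ[X], S.natDegree ≤ n → ∀ a < n - 1, X ^ a * S ∈ degreeLT ℚ (2 * n - 1) := by
    intro S hS a ha
    rw [mem_degreeLT]
    by_cases h0 : X ^ a * S = 0
    · rw [h0, degree_zero]; exact WithBot.bot_lt_coe _
    rw [degree_eq_natDegree h0]
    have := natDegree_mul_le (p := (X : ℚ[X]) ^ a) (q := S)
    rw [natDegree_X_pow] at this
    have : (X ^ a * S).natDegree < 2 * n - 1 := by omega
    exact_mod_cast this
  have htop := span_sup_multiples_eq_top (V := (V ⊓ degreeLT ℚ (2 * n - 1)) ⊔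
      (Ideal.span {P}).restrictScalars ℚ) hP hPirr hQ hR hli
    (fun f => Submodule.mem_sup_right (Ideal.mem_span_singleton.2 (dvd_mul_right P f)))
    (fun a ha => Submodule.mem_sup_left ⟨hQV a ha, hdeg Q hQ a ha⟩)
    (fun a ha => Submodule.mem_sup_left ⟨hRV a ha, hdeg R hR a ha⟩)
  have hfm : f ∈ (V ⊓ degreeLT ℚ (2 * n - 1)) ⊔ (Ideal.span {P}).restrictScalars ℚ := by
    rw [htop]; trivial
  obtain ⟨v, ⟨hvV, hvd⟩, w, hw, rfl⟩ := Submodule.mem_sup.1 hfm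
  refine V.add_mem hvV ?_
  obtain ⟨t, rfl⟩ := Ideal.mem_span_singleton.1 hw
  have ht : P * t ∈ degreeLT ℚ (2 * n - 1) := by
    have := Submodule.sub_mem _ (mem_degreeLT.2 hf) hvd
    simpa using this
  rw [mul_comm]
  refine mul_mem_of_X_pow_mul_mem (m := n - 1) ?_ hPV
  by_cases ht0 : t = 0
  · rw [ht0, degree_zero]; exact WithBot.bot_lt_coe _
  rw [mem_degreeLT, degree_mul, degree_eq_natDegree hP0, degree_eq_natDegree ht0, hP] at ht
  have h1 : n + t.natDegree < 2 * n - 1 := by exact_mod_cast ht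
  rw [degree_eq_natDegree ht0]
  have : t.natDegree < n - 1 := by omega
  exact_mod_cast this

/-- An estimate for three independent integer polynomials, one of which is irreducible. -/
lemma independent_estimate (n : ℕ) (hn : 2 ≤ n) (ξ : ℝ) : ∃ c : ℝ, 1 ≤ c ∧
    ∀ (S : Fin 3 → ℤ[X]) (h ε : ℝ), (S 0).natDegree = n →
    Irreducible ((S 0).map (Int.castRingHom ℚ)) → (∀ i, (S i).natDegree ≤ n) →
    Independent₃ ((S 0).map (Int.castRingHom ℚ)) ((S 1).map (Int.castRingHom ℚ))
      ((S 2).map (Int.castRingHom ℚ)) →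
    0 < h → (∀ i, intMahler (S i) ≤ h) → (∀ i, |aeval ξ (S i)| ≤ ε) →
    1 ≤ c * (h ^ (2 * n - 2) * ε) := by
  have hx : 1 ≤ 1 + |ξ| := by linarith [abs_nonneg ξ]
  have hB : (1 : ℝ) ≤ 2 ^ n := one_le_pow₀ (by norm_num)
  refine ⟨(2 * n - 1).factorial * (1 + |ξ|) ^ n * (2 ^ n) ^ (2 * n - 2), ?_, ?_⟩
  · have h1 : (1 : ℝ) ≤ (2 * n - 1).factorial := by exact_mod_cast Nat.factorial_pos _
    have h2 : 1 ≤ (1 + |ξ|) ^ n := one_le_pow₀ hx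
    have h3 : (1 : ℝ) ≤ (2 ^ n) ^ (2 * n - 2) := one_le_pow₀ hB
    exact one_le_mul_of_one_le_of_one_le (one_le_mul_of_one_le_of_one_le h1 h2) h3
  intro S h ε hS0 hirr hS hli hh hM hε
  have hinj : Function.Injective (Int.castRingHom ℚ) := Int.cast_injective
  let g : Fin (n - 1) × Fin 3 → ℤ[X] := fun a => X ^ (a.1 : ℕ) * S a.2
  let δ := (1 + |ξ|) ^ n * ε / (2 ^ n * h)
  obtain ⟨e, -, hmain⟩ := one_le_of_span (d := 2 * n - 1) (by omega) g (by
      rintro ⟨a, i⟩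
      have := natDegree_mul_le (p := (X : ℤ[X]) ^ (a : ℕ)) (q := S i)
      rw [natDegree_X_pow] at this
      have h2 := hS i
      simp only [g]
      omega) ξ δ (fun _ => 2 ^ n * h) (by
      rintro ⟨a, i⟩ j
      refine (abs_coeff_X_pow_mul_le (hS i) _ _).trans ?_
      gcongr
      exact hM i) (by
      rintro ⟨a, i⟩
      refine (abs_aeval_X_pow_mul_le (by omega : (a : ℕ) ≤ n) (S i) ξ).trans ?_
      have : δ * (2 ^ n * h) = (1 + |ξ|) ^ n * ε := by simp only [δ]; field_simp
      rw [this]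
      gcongr
      exact hε i) (by
      intro f hf
      have hmem : ∀ i : Fin 3, ∀ a < n - 1, X ^ a * (S i).map (Int.castRingHom ℚ) ∈
          Submodule.span ℚ (Set.range fun i => (g i).map (Int.castRingHom ℚ)) := by
        intro i a ha
        exact Submodule.subset_span ⟨(⟨a, ha⟩, i), by simp [g]⟩
      refine mem_span_of_independent hn ?_ hirr ?_ ?_ hli (hmem 0) (hmem 1) (hmem 2) hf
      · rwa [natDegree_map_eq_of_injective hinj]
      · rw [natDegree_map_eq_of_injective hinj]; exact hS 1
      · rw [natDegree_map_eq_of_injective hinj]; exact hS 2)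
  refine hmain.trans_eq ?_
  have h2 : 2 * n - 1 = (2 * n - 2) + 1 := by omega
  simp only [Finset.prod_const, Finset.card_univ, Fintype.card_fin, δ]
  rw [h2, pow_succ, ← h2]
  field_simp
  rw [mul_pow]
  ring

lemma exists_irreducible_factor_le (w : ℤ[X] → ℝ)
    (hmul : ∀ P Q, P ≠ 0 → Q ≠ 0 → w (P * Q) = w P * w Q)
    (hconst : ∀ P, P ≠ 0 → P.natDegree = 0 → 1 ≤ w P) {c : ℝ} (hc : 1 ≤ c) (P : ℤ[X])
    (hP : 0 < P.natDegree) (hPc : w P ≤ c) :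
    ∃ R, Irreducible R ∧ R ∣ P ∧ 0 < R.natDegree ∧ w R ≤ c := by
  induction P using (wellFounded_dvdNotUnit (α := ℤ[X])).induction with
  | _ P ih =>
  have hP0 : P ≠ 0 := by rintro rfl; simp at hP
  by_cases hirr : Irreducible P
  · exact ⟨P, hirr, dvd_rfl, hP, hPc⟩
  have hu : ¬ IsUnit P := fun h => by
    rw [natDegree_eq_zero_of_isUnit h] at hP; exact lt_irrefl _ hP
  rw [irreducible_iff] at hirr
  push Not at hirr
  obtain ⟨a, b, hab, ha, hb⟩ := hirr hu
  subst hab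
  have ha0 : a ≠ 0 := left_ne_zero_of_mul hP0
  have hb0 : b ≠ 0 := right_ne_zero_of_mul hP0
  have hda : DvdNotUnit a (a * b) := ⟨ha0, b, hb, rfl⟩
  have hdb : DvdNotUnit b (a * b) := ⟨hb0, a, ha, mul_comm _ _⟩
  rw [natDegree_mul ha0 hb0] at hP
  rw [hmul a b ha0 hb0] at hPc
  have fa : 0 < a.natDegree → w a ≤ c → ∃ R, Irreducible R ∧ R ∣ a * b ∧ 0 < R.natDegree ∧
      w R ≤ c := fun h1 h2 => by
    obtain ⟨R, h3, h4, h5⟩ := ih a hda h1 h2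
    exact ⟨R, h3, h4.mul_right b, h5⟩
  have fb : 0 < b.natDegree → w b ≤ c → ∃ R, Irreducible R ∧ R ∣ a * b ∧ 0 < R.natDegree ∧
      w R ≤ c := fun h1 h2 => by
    obtain ⟨R, h3, h4, h5⟩ := ih b hdb h1 h2
    exact ⟨R, h3, h4.mul_left a, h5⟩
  rcases Nat.eq_zero_or_pos a.natDegree with h | h
  · exact fb (by omega) (by nlinarith [hconst a ha0 h])
  rcases Nat.eq_zero_or_pos b.natDegree with h' | h'
  · exact fa h (by nlinarith [hconst b hb0 h'])
  by_cases h1 : w a ≤ c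
  · exact fa h h1
  · exact fb h' (by nlinarith)

/-- `R` is an irreducible polynomial whose value at `ξ` is small compared to the scale `N`. -/
structure IsSmallAt (ξ : ℝ) (n : ℕ) (c N : ℝ) (R : ℤ[X]) : Prop where
  irreducible : Irreducible R
  leadingCoeff_pos : 0 < R.leadingCoeff
  natDegree_pos : 0 < R.natDegree
  natDegree_le : R.natDegree ≤ n
  weight_le : N ^ R.natDegree * intMahler R ^ (n - 1) * |aeval ξ R| ≤ c
  intMahler_le : intMahler R ≤ c * N
  value_le : R.natDegree = n → N ^ (2 * n - 1) * |aeval ξ R| ≤ 1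

lemma one_le_abs_aeval_of_natDegree_eq_zero {P : ℤ[X]} (hP : P ≠ 0) (h : P.natDegree = 0)
    (ξ : ℝ) : 1 ≤ |aeval ξ P| := by
  rw [eq_C_of_natDegree_eq_zero h] at hP ⊢
  simp only [ne_eq, C_eq_zero] at hP
  rw [aeval_C, algebraMap_int_eq, eq_intCast]
  exact_mod_cast Int.one_le_abs hP

lemma exists_isSmallAt {ξ : ℝ} {n N : ℕ} (hn : 2 ≤ n) (hN : 2 ≤ N) {P : ℤ[X]} (hP0 : P ≠ 0)
    (hPn : P.natDegree ≤ n) (hPN : intPolyHeight P ≤ N)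
    (hPξ : |aeval ξ P| ≤ (N : ℝ) ^ (-(2 * (n : ℤ)) + 1)) :
    ∃ R, IsSmallAt ξ n ((n + 1) ^ n) N R := by
  have hN1 : (1 : ℝ) ≤ N := by exact_mod_cast (by omega : 1 ≤ N)
  have hNpos : (0 : ℝ) < N := by linarith
  have hn1 : (1 : ℝ) ≤ n + 1 := by linarith [(Nat.cast_nonneg n : (0 : ℝ) ≤ n)]
  have hval : (N : ℝ) ^ (2 * n - 1) * |aeval ξ P| ≤ 1 := by
    have h1 : (N : ℝ) ^ (2 * n - 1) * (N : ℝ) ^ (-(2 * (n : ℤ)) + 1) = 1 := by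
      rw [← zpow_natCast, ← zpow_add₀ hNpos.ne']
      have : ((2 * n - 1 : ℕ) : ℤ) + (-(2 * (n : ℤ)) + 1) = 0 := by omega
      rw [this, zpow_zero]
    calc (N : ℝ) ^ (2 * n - 1) * |aeval ξ P|
        ≤ (N : ℝ) ^ (2 * n - 1) * (N : ℝ) ^ (-(2 * (n : ℤ)) + 1) := by gcongr
      _ = 1 := h1
  have hMP := one_le_intMahler hP0
  have hMPN := intMahler_le_height hPn hPN
  have hdeg : 0 < P.natDegree := by
    by_contra! h
    have h1 := one_le_abs_aeval_of_natDegree_eq_zero hP0 (by omega) ξ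
    have h2 : (2 : ℝ) ≤ N := by exact_mod_cast hN
    have h3 : (N : ℝ) ^ 1 ≤ (N : ℝ) ^ (2 * n - 1) := pow_le_pow_right₀ hN1 (by omega)
    rw [pow_one] at h3
    nlinarith
  have hc1 : ((n : ℝ) + 1) ^ (n - 1) ≤ (n + 1) ^ n := pow_le_pow_right₀ hn1 (by omega)
  have hc2 : ((n : ℝ) + 1) ≤ (n + 1) ^ n := le_self_pow₀ hn1 (by omega)
  have hw : (N : ℝ) ^ P.natDegree * intMahler P ^ (n - 1) * |aeval ξ P| ≤ (n + 1) ^ n := by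
    calc (N : ℝ) ^ P.natDegree * intMahler P ^ (n - 1) * |aeval ξ P|
        ≤ (N : ℝ) ^ n * ((n + 1) * N) ^ (n - 1) * |aeval ξ P| := by gcongr
      _ = (n + 1) ^ (n - 1) * ((N : ℝ) ^ (2 * n - 1) * |aeval ξ P|) := by
        have : 2 * n - 1 = n + (n - 1) := by omega
        rw [this, pow_add, mul_pow]; ring
      _ ≤ (n + 1) ^ (n - 1) * 1 := by gcongr
      _ ≤ (n + 1) ^ n := by rw [mul_one]; exact hc1
  obtain ⟨R, hR, hRP, hRd, hRw⟩ := exists_irreducible_factor_le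
    (fun P => (N : ℝ) ^ P.natDegree * intMahler P ^ (n - 1) * |aeval ξ P|)
    (fun P Q hP hQ => by
      rw [natDegree_mul hP hQ, intMahler_mul, map_mul, abs_mul, pow_add, mul_pow]; ring)
    (fun P hP h => by
      rw [h, pow_zero, one_mul]
      exact one_le_mul_of_one_le_of_one_le (one_le_pow₀ (one_le_intMahler hP))
        (one_le_abs_aeval_of_natDegree_eq_zero hP h ξ)) (hn1.trans hc2) P hdeg hw
  have hRM : intMahler R ≤ (n + 1) ^ n * N := by
    obtain ⟨S, rfl⟩ := hRP
    rw [intMahler_mul] at hMPN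
    have h1 := one_le_intMahler (left_ne_zero_of_mul hP0)
    have h2 := one_le_intMahler (right_ne_zero_of_mul hP0)
    calc intMahler R ≤ intMahler R * intMahler S := le_mul_of_one_le_right (by linarith) h2
      _ ≤ (n + 1) * N := hMPN
      _ ≤ (n + 1) ^ n * N := by gcongr
  have hRn : R.natDegree ≤ n := (natDegree_le_of_dvd hRP hP0).trans hPn
  have hRv : R.natDegree = n → (N : ℝ) ^ (2 * n - 1) * |aeval ξ R| ≤ 1 := by
    intro h
    obtain ⟨S, rfl⟩ := hRP
    have hS0 := right_ne_zero_of_mul hP0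
    rw [natDegree_mul (left_ne_zero_of_mul hP0) hS0] at hPn
    have h1 := one_le_abs_aeval_of_natDegree_eq_zero hS0 (by omega) ξ
    refine le_trans ?_ hval
    rw [map_mul, abs_mul]
    gcongr
    exact le_mul_of_one_le_right (abs_nonneg _) h1
  rcases lt_or_ge 0 R.leadingCoeff with h | h
  · exact ⟨R, hR, h, hRd, hRn, hRw, hRM, hRv⟩
  · have h0 : R.leadingCoeff ≠ 0 := leadingCoeff_ne_zero.2 hR.ne_zero
    refine ⟨-R, (Associated.refl R).neg_right.irreducible hR, ?_, ?_, ?_, ?_, ?_, ?_⟩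
    · rw [leadingCoeff_neg]; omega
    · rwa [natDegree_neg]
    · rwa [natDegree_neg]
    · rwa [natDegree_neg, intMahler_neg, map_neg, abs_neg]
    · rwa [intMahler_neg]
    · rwa [natDegree_neg, map_neg, abs_neg]

lemma irreducible_map_rat {R : ℤ[X]} (hR : Irreducible R) (hd : 0 < R.natDegree) :
    Irreducible (R.map (Int.castRingHom ℚ)) :=
  (IsPrimitive.Int.irreducible_iff_irreducible_map_cast (hR.isPrimitive (by omega))).1 hR

lemma isCoprime_of_ne {R S : ℤ[X]} (hR : Irreducible R) (hS : Irreducible S)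
    (hRd : 0 < R.natDegree) (hSd : 0 < S.natDegree) (hRl : 0 < R.leadingCoeff)
    (hSl : 0 < S.leadingCoeff) (hne : R ≠ S) :
    IsCoprime (R.map (Int.castRingHom ℚ)) (S.map (Int.castRingHom ℚ)) := by
  refine (dvd_or_isCoprime _ _ (irreducible_map_rat hR hRd)).resolve_left fun h => hne ?_
  rw [← IsPrimitive.Int.dvd_iff_map_cast_dvd_map_cast _ _ (hR.isPrimitive (by omega))] at h
  obtain ⟨u, rfl⟩ := hR.associated_of_dvd hS h
  obtain ⟨r, hr, hru⟩ := Polynomial.isUnit_iff.1 u.isUnit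
  rcases Int.isUnit_iff.1 hr with rfl | rfl
  · rw [← hru]; simp
  · rw [← hru] at hSl
    simp at hSl
    have hz := leadingCoeff_ne_zero.2 hR.ne_zero
    omega

/-- At consecutive scales, a change of the small irreducible polynomial forces its degree to be
maximal and its Mahler measure to be comparable with the scale. -/
lemma exists_scale_ratio {ξ : ℝ} {n : ℕ} (hn : 2 ≤ n) {c : ℝ} (hc : 1 ≤ c) :
    ∃ (K : ℕ) (b : ℝ), 2 ≤ K ∧ 1 ≤ b ∧ ∀ (N : ℝ) (R S : ℤ[X]), 1 ≤ N → b < intMahler R →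
      IsSmallAt ξ n c N R → IsSmallAt ξ n c (K * N) S → R ≠ S →
      S.natDegree = n ∧ (R.natDegree = n → N ≤ b * intMahler R) := by
  obtain ⟨c₁, hc₁, hres⟩ := resultant_estimate n ξ
  obtain ⟨K, hK⟩ := exists_nat_gt (max 2 (c₁ * c * c ^ n))
  have hK2 : (2 : ℝ) < K := (le_max_left _ _).trans_lt hK
  have hKc : c₁ * c * c ^ n < K := (le_max_right _ _).trans_lt hK
  have hK1 : (1 : ℝ) ≤ K := by linarith
  have hcK : 1 ≤ c * K := one_le_mul_of_one_le_of_one_le hc hK1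
  have hb : 1 ≤ c₁ * c * (c * K) ^ n :=
    one_le_mul_of_one_le_of_one_le (one_le_mul_of_one_le_of_one_le hc₁ hc) (one_le_pow₀ hcK)
  refine ⟨K, c₁ * c * (c * K) ^ n, by exact_mod_cast hK2.le, hb, ?_⟩
  intro N R S hN hbR hR hS hne
  have hco := isCoprime_of_ne hR.irreducible hS.irreducible hR.natDegree_pos hS.natDegree_pos
    hR.leadingCoeff_pos hS.leadingCoeff_pos hne
  have hR1 := one_le_intMahler hR.irreducible.ne_zero
  have hS1 := one_le_intMahler hS.irreducible.ne_zero
  have hRw := hR.weight_le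
  have hSw := hS.weight_le
  have hRN := hR.intMahler_le
  have hSN := hS.intMahler_le
  have hRv := hR.value_le
  have hrn := hR.natDegree_le
  have hsn := hS.natDegree_le
  have hr0 := hR.natDegree_pos
  have hs0 := hS.natDegree_pos
  have hest := hres R S hR.irreducible.ne_zero hS.irreducible.ne_zero hr0 hrn hsn hco
  set r := R.natDegree
  set s := S.natDegree
  set h := intMahler R
  set k := intMahler S
  have hh0 : 0 < h := by linarith
  have hk0 : 0 < k := by linarith
  have hN0 : 0 < N := by linarith
  have hSN' : k ≤ c * K * N := by linarith
  have hn1 : n = (n - 1) + 1 := by omega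
  have hcK0 : 0 ≤ c * K := by linarith
  rcases hest with hest | hest
  · have hks : k ^ r ≤ (c * K) ^ n * N ^ r := by
      calc k ^ r ≤ (c * K * N) ^ r := by gcongr
        _ = (c * K) ^ r * N ^ r := mul_pow _ _ _
        _ ≤ (c * K) ^ n * N ^ r := by gcongr
    have hs : s = n := by
      by_contra hs
      have h1 : h ^ n * N ^ r ≤ c₁ * c * (h ^ s * ((c * K) ^ n * N ^ r)) := by
        calc h ^ n * N ^ r = h * (N ^ r * h ^ (n - 1)) := by
              conv_lhs => rw [hn1, pow_succ]
              ring
          _ ≤ c₁ * (h ^ s * k ^ r * |aeval ξ R|) * (N ^ r * h ^ (n - 1)) := by gcongr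
          _ = c₁ * (h ^ s * k ^ r) * (N ^ r * h ^ (n - 1) * |aeval ξ R|) := by ring
          _ ≤ c₁ * (h ^ s * ((c * K) ^ n * N ^ r)) * c := by gcongr
          _ = c₁ * c * (h ^ s * ((c * K) ^ n * N ^ r)) := by ring
      have h2 : h * h ^ s ≤ h ^ n := by
        rw [← pow_succ']; exact pow_le_pow_right₀ hR1 (by omega)
      have h3 : h * (h ^ s * N ^ r) ≤ c₁ * c * (c * K) ^ n * (h ^ s * N ^ r) := by
        calc h * (h ^ s * N ^ r) = h * h ^ s * N ^ r := by ring
          _ ≤ h ^ n * N ^ r := by gcongr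
          _ ≤ _ := h1
          _ = _ := by ring
      have h4 := le_of_mul_le_mul_right h3 (by positivity)
      linarith
    refine ⟨hs, fun hr => ?_⟩
    rw [hs, hr] at hest
    rw [hr] at hks
    have h1 : N ^ (2 * n - 1) * h ≤ c₁ * (h ^ n * ((c * K) ^ n * N ^ n)) := by
      calc N ^ (2 * n - 1) * h
          ≤ N ^ (2 * n - 1) * (c₁ * (h ^ n * k ^ n * |aeval ξ R|)) := by gcongr
        _ = c₁ * (h ^ n * k ^ n) * (N ^ (2 * n - 1) * |aeval ξ R|) := by ring
        _ ≤ c₁ * (h ^ n * ((c * K) ^ n * N ^ n)) * 1 := by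
          gcongr
          exact hRv hr
        _ = _ := mul_one _
    have h2 : N ^ (n - 1) * (N ^ n * h) ≤ c₁ * (c * K) ^ n * h ^ (n - 1) * (N ^ n * h) := by
      calc N ^ (n - 1) * (N ^ n * h) = N ^ (2 * n - 1) * h := by
            rw [← mul_assoc, ← pow_add]; congr 2; omega
        _ ≤ _ := h1
        _ = c₁ * (c * K) ^ n * h ^ (n - 1) * (N ^ n * h) := by
            have : h ^ n = h ^ (n - 1) * h := by rw [← pow_succ, ← hn1]
            rw [this]; ring
    have h3 := le_of_mul_le_mul_right h2 (by positivity)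
    have h4 : N ^ (n - 1) ≤ (c₁ * c * (c * K) ^ n * h) ^ (n - 1) := by
      rw [mul_pow]
      refine h3.trans ?_
      gcongr
      calc c₁ * (c * K) ^ n ≤ c₁ * c * (c * K) ^ n := by
            have : 0 ≤ c₁ * (c * K) ^ n := by positivity
            nlinarith
        _ ≤ (c₁ * c * (c * K) ^ n) ^ (n - 1) := le_self_pow₀ hb (by omega)
    exact le_of_pow_le_pow_left₀ (by omega) (by positivity) h4
  · exfalso
    have hcN : h ^ s ≤ c ^ n * N ^ s := by
      calc h ^ s ≤ (c * N) ^ s := by gcongr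
        _ = c ^ s * N ^ s := mul_pow _ _ _
        _ ≤ c ^ n * N ^ s := by gcongr
    have h1 : k ^ n * (K * N) ^ s ≤ c₁ * c * c ^ n * (k ^ n * N ^ s) := by
      calc k ^ n * (K * N) ^ s = k * ((K * N) ^ s * k ^ (n - 1)) := by
            conv_lhs => rw [hn1, pow_succ]
            ring
        _ ≤ c₁ * (h ^ s * k ^ r * |aeval ξ S|) * ((K * N) ^ s * k ^ (n - 1)) := by gcongr
        _ = c₁ * (h ^ s * k ^ r) * ((K * N) ^ s * k ^ (n - 1) * |aeval ξ S|) := by ring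
        _ ≤ c₁ * (c ^ n * N ^ s * k ^ n) * c := by gcongr
        _ = _ := by ring
    have h2 : (K : ℝ) ^ s * (k ^ n * N ^ s) ≤ c₁ * c * c ^ n * (k ^ n * N ^ s) := by
      rw [mul_pow] at h1; linarith
    have h3 := le_of_mul_le_mul_right h2 (by positivity)
    have h4 : (K : ℝ) ≤ (K : ℝ) ^ s := le_self_pow₀ hK1 (by omega)
    linarith

lemma mul_abs_aeval_le {ξ : ℝ} {n : ℕ} {c N : ℝ} {R : ℤ[X]} (hN : 1 ≤ N)
    (hR : IsSmallAt ξ n c N R) : N * |aeval ξ R| ≤ c := by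
  have h1 := one_le_intMahler hR.irreducible.ne_zero
  have h2 : N ≤ N ^ R.natDegree := le_self_pow₀ hN hR.natDegree_pos.ne'
  have h3 : 1 ≤ intMahler R ^ (n - 1) := one_le_pow₀ h1
  refine le_trans ?_ hR.weight_le
  gcongr
  nlinarith

lemma exists_scale_lt_intMahler {ξ : ℝ} {n : ℕ}
    (hξ : ∀ Q : ℤ[X], Q ≠ 0 → Q.natDegree ≤ n → aeval ξ Q ≠ 0) (c b : ℝ) (hb : 1 ≤ b) :
    ∃ N₀ : ℝ, ∀ N R, N₀ ≤ N → IsSmallAt ξ n c N R → b < intMahler R := by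
  have hfin := finite_mahlerMeasure_le n ⟨b, by linarith⟩
  obtain ⟨η, hη⟩ := (hfin.image fun p : ℤ[X] => c / |aeval ξ p|).bddAbove
  refine ⟨max 1 (η + 1), fun N R hN hR => ?_⟩
  have hN1 := (le_max_left _ _).trans hN
  have hN2 := (le_max_right _ _).trans hN
  by_contra! h
  have h1 := hη ⟨R, ⟨hR.natDegree_le, h⟩, rfl⟩
  have h2 := mul_abs_aeval_le hN1 hR
  have h3 : 0 < |aeval ξ R| := abs_pos.2 (hξ R hR.irreducible.ne_zero hR.natDegree_le)
  rw [← le_div_iff₀ h3] at h2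
  simp only at h1
  linarith

/-- A sequence of irreducible polynomials of maximal degree at geometrically growing scales. -/
lemma exists_irreducible_sequence {ξ : ℝ} {n : ℕ} (hn : 2 ≤ n) {c : ℝ} (hc : 1 ≤ c)
    (hξ : ∀ Q : ℤ[X], Q ≠ 0 → Q.natDegree ≤ n → aeval ξ Q ≠ 0) {N₁ : ℕ}
    (h : ∀ N : ℕ, N₁ ≤ N → ∃ R, IsSmallAt ξ n c N R) :
    ∃ (T : ℕ → ℤ[X]) (A : ℕ → ℝ) (L : ℝ), 1 < L ∧ 1 ≤ A 0 ∧ (∀ k, A (k + 1) = L * A k) ∧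
      (∀ k, IsSmallAt ξ n c (A k) (T k)) ∧ (∀ k, (T k).natDegree = n) ∧
      ∀ k, T k ≠ T (k + 1) := by
  obtain ⟨K, b, hK, hb, hstep⟩ := exists_scale_ratio (ξ := ξ) hn hc
  obtain ⟨N₀, hN₀⟩ := exists_scale_lt_intMahler hξ c b hb
  obtain ⟨M, hM⟩ := exists_nat_ge (max N₀ 1)
  have hMN : N₀ ≤ M := (le_max_left _ _).trans hM
  have hM1 : (1 : ℝ) ≤ M := (le_max_right _ _).trans hM
  have hK1 : (1 : ℝ) < K := by exact_mod_cast (by omega : 1 < K)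
  have hpow1 : ∀ k : ℕ, 1 ≤ (K : ℝ) ^ k := fun k => one_le_pow₀ hK1.le
  obtain ⟨B, hB⟩ : ∃ B : ℕ, B = max M N₁ := ⟨_, rfl⟩
  have hBM : (M : ℝ) ≤ B := by rw [hB]; exact_mod_cast le_max_left _ _
  let A : ℕ → ℝ := fun k => (B * K ^ k : ℕ)
  have hAs : ∀ k d, A (k + d) = K ^ d * A k := by
    intro k d; simp only [A]; push_cast; ring
  have hA1 : ∀ k, (B : ℝ) ≤ A k := by
    intro k
    have := hpow1 k
    simp only [A]; push_cast
    nlinarith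
  have hA : ∀ k, ∃ R, IsSmallAt ξ n c (A k) R := fun k => h _ (by
    rw [hB]
    exact (le_max_right M N₁).trans (Nat.le_mul_of_pos_right _ (Nat.pow_pos (by omega))))
  choose R hR using hA
  have hlt : ∀ k, b < intMahler (R k) := fun k => hN₀ _ _ (by linarith [hA1 k]) (hR k)
  have hstep' : ∀ k, R k ≠ R (k + 1) →
      (R (k + 1)).natDegree = n ∧ ((R k).natDegree = n → A k ≤ b * intMahler (R k)) := by
    intro k hk
    refine hstep (A k) _ _ (by linarith [hA1 k]) (hlt k) (hR k) ?_ hk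
    have := hR (k + 1)
    rwa [hAs, pow_one] at this
  have htend : Filter.Tendsto A Filter.atTop Filter.atTop := by
    have : A = fun k => (B : ℝ) * (K : ℝ) ^ k := by funext k; simp [A]
    rw [this]
    exact (tendsto_pow_atTop_atTop_of_one_lt hK1).const_mul_atTop (by linarith)
  have hchange : ∀ k, ∃ m, k < m ∧ R m ≠ R k := by
    intro k
    by_contra! hk
    have h0 : 0 < |aeval ξ (R k)| :=
      abs_pos.2 (hξ _ (hR k).irreducible.ne_zero (hR k).natDegree_le)
    obtain ⟨m, hm1, hm2⟩ := ((htend.eventually_gt_atTop (c / |aeval ξ (R k)|)).and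
      (Filter.eventually_gt_atTop k)).exists
    have h1 := mul_abs_aeval_le (by linarith [hA1 m]) (hR m)
    rw [hk m hm2] at h1
    rw [div_lt_iff₀ h0] at hm1
    linarith
  have hlast : ∀ k, ∃ l, k ≤ l ∧ R l = R k ∧ R l ≠ R (l + 1) := by
    intro k
    classical
    obtain ⟨h1, h2⟩ := Nat.find_spec (hchange k)
    obtain ⟨l, hl⟩ : ∃ l, Nat.find (hchange k) = l + 1 := ⟨Nat.find (hchange k) - 1, by omega⟩
    rw [hl] at h1 h2
    have h3 : R l = R k := by
      rcases (Nat.lt_succ_iff.1 h1).eq_or_lt with h | h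
      · rw [h]
      · have := Nat.find_min (hchange k) (m := l) (by omega)
        push Not at this
        exact this h
    exact ⟨l, by omega, h3, fun h => h2 (by rw [← h, h3])⟩
  obtain ⟨j, -, -, hj⟩ := hlast 0
  have hdeg : ∀ k, (R (j + 1 + k)).natDegree = n := by
    intro k
    induction k with
    | zero => exact (hstep' j hj).1
    | succ k ih =>
      by_cases h : R (j + 1 + k) = R (j + 1 + k + 1)
      · rw [← add_assoc, ← h, ih]
      · exact (hstep' _ h).1
  have hlow : ∀ k, A (j + 1 + k) ≤ b * intMahler (R (j + 1 + k)) := by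
    intro k
    obtain ⟨l, hl1, hl2, hl3⟩ := hlast (j + 1 + k)
    have h1 := (hstep' l hl3).2 (by rw [hl2]; exact hdeg k)
    rw [hl2] at h1
    refine le_trans ?_ h1
    obtain ⟨d, rfl⟩ := Nat.exists_eq_add_of_le hl1
    rw [hAs (j + 1 + k) d]
    have := hpow1 d
    nlinarith [hA1 (j + 1 + k)]
  obtain ⟨d, hd⟩ := pow_unbounded_of_one_lt (b * c) hK1
  have hbc : 1 ≤ b * c := one_le_mul_of_one_le_of_one_le hb hc
  refine ⟨fun k => R (j + 1 + k * d), fun k => A (j + 1 + k * d), K ^ d, by linarith,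
    by linarith [hA1 (j + 1 + 0 * d)], fun k => ?_, fun k => hR _, fun k => hdeg _, fun k heq => ?_⟩
  · have h3 : j + 1 + (k + 1) * d = j + 1 + k * d + d := by ring
    simp only [h3, hAs]
  · have h1 := hlow ((k + 1) * d)
    simp only at heq
    rw [← heq] at h1
    have h2 := (hR (j + 1 + k * d)).intMahler_le
    have h3 : A (j + 1 + (k + 1) * d) = K ^ d * A (j + 1 + k * d) := by
      rw [← hAs]; congr 1; ring
    have h4 := hA1 (j + 1 + k * d)
    rw [h3] at h1
    have h5 : b * intMahler (R (j + 1 + k * d)) ≤ b * (c * A (j + 1 + k * d)) := by gcongr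
    have h6 : (b * c) * A (j + 1 + k * d) < K ^ d * A (j + 1 + k * d) := by
      apply mul_lt_mul_of_pos_right hd; linarith
    linarith

lemma eq_zero_of_isCoprime_of_add_eq_zero {P Q : ℚ[X]} (hPQ : IsCoprime P Q)
    (hQ : 0 < Q.natDegree) {x y : ℚ} (h : C x * P + C y * Q = 0) :
    x = 0 ∧ y = 0 := by
  have hQ0 : Q ≠ 0 := by rintro rfl; simp at hQ
  have hx : x = 0 := by
    by_contra hx
    have h1 : Q ∣ C x * P := ⟨-C y, by linear_combination h⟩
    have h2 : Q ∣ C x := hPQ.symm.dvd_of_dvd_mul_right h1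
    have h3 := natDegree_le_of_dvd h2 (by simpa using hx)
    rw [natDegree_C] at h3
    omega
  refine ⟨hx, ?_⟩
  simpa [hx, hQ0] using h

/-- The combination of two integer polynomials which cancels the leading coefficients. -/
noncomputable def leadCombination (P Q : ℤ[X]) : ℤ[X] :=
  C P.leadingCoeff * Q - C Q.leadingCoeff * P

lemma map_leadCombination_proportional {P Q R : ℤ[X]} {n : ℕ} (hPn : P.natDegree = n)
    (hQn : Q.natDegree = n) (hRn : R.natDegree = n) (hn : 0 < n)
    (hPQ : IsCoprime (P.map (Int.castRingHom ℚ)) (Q.map (Int.castRingHom ℚ)))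
    (hdep : ¬ Independent₃ (P.map (Int.castRingHom ℚ)) (Q.map (Int.castRingHom ℚ))
      (R.map (Int.castRingHom ℚ))) :
    ∃ t : ℚ, (leadCombination Q R).map (Int.castRingHom ℚ) =
      C t * (leadCombination P Q).map (Int.castRingHom ℚ) := by
  have hinj : Function.Injective (Int.castRingHom ℚ) := Int.cast_injective
  unfold Independent₃ at hdep
  push Not at hdep
  obtain ⟨x, y, z, h, hne⟩ := hdep
  have hz : z ≠ 0 := by
    rintro rfl
    have h1 := eq_zero_of_isCoprime_of_add_eq_zero (x := x) (y := y) hPQ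
      (by rw [natDegree_map_eq_of_injective hinj]; omega) (by simpa using h)
    exact hne h1.1 h1.2 rfl
  have hlead : x * P.leadingCoeff + y * Q.leadingCoeff + z * R.leadingCoeff = 0 := by
    have h1 := congrArg (fun f : ℚ[X] => f.coeff n) h
    simp only [coeff_add, coeff_C_mul, coeff_map, coeff_zero] at h1
    rw [leadingCoeff, leadingCoeff, leadingCoeff, hPn, hQn, hRn]
    simpa using h1
  refine ⟨x / z, mul_left_cancel₀ (C_ne_zero.2 hz) ?_⟩
  rw [← mul_assoc, ← C_mul, mul_div_cancel₀ _ hz]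
  have hlead' : C x * C (P.leadingCoeff : ℚ) + C y * C (Q.leadingCoeff : ℚ) +
      C z * C (R.leadingCoeff : ℚ) = 0 := by
    rw [← C_mul, ← C_mul, ← C_mul, ← C_add, ← C_add, hlead, C_0]
  simp only [leadCombination, Polynomial.map_sub, Polynomial.map_mul, Polynomial.map_C,
    Int.coe_castRingHom]
  linear_combination C (Q.leadingCoeff : ℚ) * h - Q.map (Int.castRingHom ℚ) * hlead'

lemma leadCombination_ne_zero {P Q : ℤ[X]} (hQ : 0 < Q.natDegree) (hP : P ≠ 0)
    (hPQ : IsCoprime (P.map (Int.castRingHom ℚ)) (Q.map (Int.castRingHom ℚ))) :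
    leadCombination P Q ≠ 0 := by
  intro h
  have hinj : Function.Injective (Int.castRingHom ℚ) := Int.cast_injective
  have h1 := congrArg (Polynomial.map (Int.castRingHom ℚ)) h
  simp only [leadCombination, Polynomial.map_sub, Polynomial.map_mul, Polynomial.map_C,
    Int.coe_castRingHom, Polynomial.map_zero] at h1
  have h2 := eq_zero_of_isCoprime_of_add_eq_zero (x := -(Q.leadingCoeff : ℚ))
    (y := (P.leadingCoeff : ℚ)) hPQ
    (by rwa [natDegree_map_eq_of_injective hinj]) (by
      rw [C_neg]; linear_combination h1)
  exact leadingCoeff_ne_zero.2 hP (by exact_mod_cast h2.2)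

lemma natDegree_leadCombination_le {P Q : ℤ[X]} {n : ℕ} (hP : P.natDegree ≤ n)
    (hQ : Q.natDegree ≤ n) : (leadCombination P Q).natDegree ≤ n :=
  (natDegree_sub_le _ _).trans (max_le ((natDegree_C_mul_le _ _).trans hQ)
    ((natDegree_C_mul_le _ _).trans hP))

lemma abs_aeval_leadCombination_le {P Q : ℤ[X]} {n : ℕ} (hP : P.natDegree ≤ n)
    (hQ : Q.natDegree ≤ n) {ξ h ε : ℝ} (hhP : intMahler P ≤ h) (hhQ : intMahler Q ≤ h)
    (hεP : |aeval ξ P| ≤ ε) (hεQ : |aeval ξ Q| ≤ ε) :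
    |aeval ξ (leadCombination P Q)| ≤ 2 * (2 ^ n * h * ε) := by
  have hh : 0 ≤ h := (mahlerMeasure_nonneg _).trans hhP
  have h1 : |(P.leadingCoeff : ℝ)| ≤ 2 ^ n * h :=
    (abs_coeff_le_intMahler hP _).trans (by gcongr)
  have h2 : |(Q.leadingCoeff : ℝ)| ≤ 2 ^ n * h :=
    (abs_coeff_le_intMahler hQ _).trans (by gcongr)
  have h3 : aeval ξ (leadCombination P Q) =
      P.leadingCoeff * aeval ξ Q - Q.leadingCoeff * aeval ξ P := by
    rw [leadCombination, map_sub, map_mul, map_mul, aeval_C, aeval_C]; simp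
  rw [h3]
  refine (abs_sub _ _).trans ?_
  rw [abs_mul, abs_mul]
  calc _ ≤ 2 ^ n * h * ε + 2 ^ n * h * ε := by gcongr
    _ = _ := by ring

lemma abs_aeval_le_of_proportional {D E : ℤ[X]} (hE : E ≠ 0) {t : ℚ}
    (h : E.map (Int.castRingHom ℚ) = C t * D.map (Int.castRingHom ℚ)) (ξ : ℝ) {i : ℕ}
    (hi : D.coeff i ≠ 0) : |aeval ξ D| ≤ |(D.coeff i : ℝ)| * |aeval ξ E| := by
  have hinj : Function.Injective (Int.castRingHom ℚ) := Int.cast_injective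
  have ht : t ≠ 0 := by
    rintro rfl
    rw [C_0, zero_mul, Polynomial.map_eq_zero_iff hinj] at h
    exact hE h
  have h1 : (E.coeff i : ℚ) = t * D.coeff i := by
    have := congrArg (fun f : ℚ[X] => f.coeff i) h
    simpa [coeff_C_mul, coeff_map] using this
  have h2 : aeval ξ E = (t : ℝ) * aeval ξ D := by
    have := congrArg (aeval ξ) h
    rw [map_mul, aeval_C] at this
    have hmap : ∀ P : ℤ[X], aeval ξ (P.map (Int.castRingHom ℚ)) = aeval ξ P := fun P => by
      rw [← algebraMap_int_eq, aeval_map_algebraMap]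
    rw [hmap, hmap] at this
    simpa using this
  have h3 : E.coeff i ≠ 0 := by
    have : (E.coeff i : ℚ) ≠ 0 := by
      rw [h1]; exact mul_ne_zero ht (by exact_mod_cast hi)
    exact_mod_cast this
  have h4 : (1 : ℝ) ≤ |(E.coeff i : ℝ)| := by exact_mod_cast Int.one_le_abs h3
  have h5 : (E.coeff i : ℝ) = t * D.coeff i := by exact_mod_cast congrArg (fun q : ℚ => (q : ℝ)) h1
  rw [h5, abs_mul] at h4
  rw [h2, abs_mul]
  nlinarith [abs_nonneg (aeval ξ D)]

lemma exists_aeval_eq_zero {ξ : ℝ} {n : ℕ} (hn : 2 ≤ n) {c : ℝ} (hc : 1 ≤ c) {N₁ : ℕ}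
    (h : ∀ N : ℕ, N₁ ≤ N → ∃ R, IsSmallAt ξ n c N R) :
    ∃ Q : ℤ[X], Q ≠ 0 ∧ Q.natDegree ≤ n ∧ aeval ξ Q = 0 := by
  by_contra! hξ
  obtain ⟨T, A, L, hL, hA0, hAs, hT, hdeg, hne⟩ := exists_irreducible_sequence hn hc hξ h
  obtain ⟨c₂, hc₂, hest⟩ := independent_estimate n hn ξ
  have hA1 : ∀ k, 1 ≤ A k := by
    intro k
    induction k with
    | zero => exact hA0
    | succ k ih => rw [hAs]; nlinarith
  have hAle : ∀ k, A k ≤ A (k + 1) := fun k => by rw [hAs]; nlinarith [hA1 k]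
  have htend : Filter.Tendsto A Filter.atTop Filter.atTop := by
    have : A = fun k => A 0 * L ^ k := by
      funext k
      induction k with
      | zero => simp
      | succ k ih => rw [hAs, ih, pow_succ]; ring
    rw [this]
    exact (tendsto_pow_atTop_atTop_of_one_lt hL).const_mul_atTop (by linarith)
  have hval : ∀ k, |aeval ξ (T k)| ≤ (A k ^ (2 * n - 1))⁻¹ := by
    intro k
    have h0 : 0 < A k ^ (2 * n - 1) := pow_pos (by linarith [hA1 k]) _
    rw [← one_div, le_div_iff₀ h0, mul_comm]
    exact (hT k).value_le (hdeg k)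
  have hinv : ∀ k, (A (k + 1) ^ (2 * n - 1))⁻¹ ≤ (A k ^ (2 * n - 1))⁻¹ := by
    intro k
    have := hA1 k
    have := hAle k
    gcongr
  have hcop : ∀ k, IsCoprime ((T k).map (Int.castRingHom ℚ))
      ((T (k + 1)).map (Int.castRingHom ℚ)) := fun k =>
    isCoprime_of_ne (hT k).irreducible (hT _).irreducible (hT k).natDegree_pos
      (hT _).natDegree_pos (hT k).leadingCoeff_pos (hT _).leadingCoeff_pos (hne k)
  have hpow : ∀ k, A k ^ (2 * n - 1) = A k ^ (2 * n - 2) * A k := by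
    intro k; rw [← pow_succ]; congr 1; omega
  have hdep : ∀ᶠ k in Filter.atTop, ¬ Independent₃ ((T k).map (Int.castRingHom ℚ))
      ((T (k + 1)).map (Int.castRingHom ℚ)) ((T (k + 2)).map (Int.castRingHom ℚ)) := by
    filter_upwards [htend.eventually_gt_atTop (c₂ * (c * L ^ 2) ^ (2 * n - 2))] with k hk hli
    have hk0 : 0 < A k := by linarith [hA1 k]
    have h0 : A (k + 2) = L ^ 2 * A k := by rw [hAs, hAs]; ring
    have h1 := hest ![T k, T (k + 1), T (k + 2)] (c * L ^ 2 * A k) (A k ^ (2 * n - 1))⁻¹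
      (hdeg k) (irreducible_map_rat (hT k).irreducible (hT k).natDegree_pos)
      (by intro i; fin_cases i <;> simp [hdeg]) hli (by positivity)
      (by
        have e : c * A (k + 2) = c * L ^ 2 * A k := by rw [h0]; ring
        rw [← e]
        have e0 := (hT k).intMahler_le
        have e1 := (hT (k + 1)).intMahler_le
        have e2 := (hT (k + 2)).intMahler_le
        have e3 : c * A k ≤ c * A (k + 1) := by gcongr; exact hAle k
        have e4 : c * A (k + 1) ≤ c * A (k + 2) := by gcongr; exact hAle (k + 1)
        intro i
        fin_cases i
        · exact (e0.trans e3).trans e4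
        · exact e1.trans e4
        · exact e2)
      (by
        intro i
        fin_cases i
        · exact hval k
        · exact (hval (k + 1)).trans (hinv k)
        · exact ((hval (k + 2)).trans (hinv (k + 1))).trans (hinv k))
    have h2 : c₂ * ((c * L ^ 2 * A k) ^ (2 * n - 2) * (A k ^ (2 * n - 1))⁻¹) =
        c₂ * (c * L ^ 2) ^ (2 * n - 2) / A k := by
      rw [hpow, mul_pow (c * L ^ 2)]
      field_simp
    rw [h2, le_div_iff₀ hk0] at h1
    linarith
  obtain ⟨m, hm⟩ := Filter.eventually_atTop.1 hdep
  let D : ℕ → ℤ[X] := fun k => leadCombination (T k) (T (k + 1))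
  have hD0 : ∀ k, D k ≠ 0 := fun k =>
    leadCombination_ne_zero (hT _).natDegree_pos (hT k).irreducible.ne_zero (hcop k)
  have hDdeg : (D m).natDegree ≤ n := natDegree_leadCombination_le (hdeg _).le (hdeg _).le
  have hprop : ∀ k, ∃ t : ℚ, (D (m + k)).map (Int.castRingHom ℚ) =
      C t * (D m).map (Int.castRingHom ℚ) := by
    intro k
    induction k with
    | zero => exact ⟨1, by simp⟩
    | succ k ih =>
      obtain ⟨t, ht⟩ := ih
      obtain ⟨s, hs⟩ := map_leadCombination_proportional (hdeg _) (hdeg _) (hdeg _) (by omega)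
        (hcop (m + k)) (hm (m + k) (by omega))
      refine ⟨s * t, ?_⟩
      rw [C_mul, mul_assoc, ← ht]
      exact hs
  obtain ⟨i, hi⟩ : ∃ i, (D m).coeff i ≠ 0 := by
    by_contra! hz
    exact hD0 m (Polynomial.ext (by simpa using hz))
  have hpos : 0 < |aeval ξ (D m)| := abs_pos.2 (hξ _ (hD0 m) hDdeg)
  set a : ℝ := |((D m).coeff i : ℝ)|
  have hsmall : ∀ k, A k * |aeval ξ (D k)| ≤ 2 * (2 ^ n * (c * L)) := by
    intro k
    have hk1 := hA1 k
    have hM0 : intMahler (T k) ≤ c * (L * A k) := by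
      rw [← hAs]; refine (hT k).intMahler_le.trans ?_; gcongr; exact hAle k
    have hM1 : intMahler (T (k + 1)) ≤ c * (L * A k) := by
      rw [← hAs]; exact (hT (k + 1)).intMahler_le
    have h1 : |aeval ξ (D k)| ≤ _ := abs_aeval_leadCombination_le (ξ := ξ) (hdeg _).le (hdeg _).le
      hM0 hM1 (hval k) ((hval (k + 1)).trans (hinv k))
    have h2 : A k ^ 2 ≤ A k ^ (2 * n - 1) := pow_le_pow_right₀ hk1 (by omega)
    calc A k * |aeval ξ (D k)|
        ≤ A k * (2 * (2 ^ n * (c * (L * A k)) * (A k ^ (2 * n - 1))⁻¹)) := by gcongr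
      _ = 2 * (2 ^ n * (c * L)) * (A k ^ 2 * (A k ^ (2 * n - 1))⁻¹) := by ring
      _ ≤ 2 * (2 ^ n * (c * L)) * 1 := by
        gcongr
        rw [← div_eq_mul_inv]
        exact div_le_one_of_le₀ h2 (by positivity)
      _ = _ := mul_one _
  have hshift : Filter.Tendsto (fun k => A (m + k)) Filter.atTop Filter.atTop :=
    htend.comp (Filter.tendsto_atTop_mono (fun k => Nat.le_add_left k m) Filter.tendsto_id)
  obtain ⟨k, hk⟩ :=
    (hshift.eventually_gt_atTop (a * (2 * (2 ^ n * (c * L))) / |aeval ξ (D m)|)).exists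
  rw [div_lt_iff₀ hpos] at hk
  obtain ⟨t, ht⟩ := hprop k
  have h1 := abs_aeval_le_of_proportional (hD0 (m + k)) ht ξ hi
  have h2 := hsmall (m + k)
  have h3 : A (m + k) * |aeval ξ (D m)| ≤ A (m + k) * (a * |aeval ξ (D (m + k))|) := by
    have := hA1 (m + k)
    gcongr
  have h4 : a * (A (m + k) * |aeval ξ (D (m + k))|) ≤ a * (2 * (2 ^ n * (c * L))) := by
    gcongr
  linarith

end DavenportSchmidt

/-- Davenport–Schmidt criterion. -/
theorem davenport_schmidt_criterion (ξ : ℝ) (n : ℕ) (hn : 2 ≤ n)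
    (h : ∃ N₁ : ℕ, ∀ N : ℕ, N₁ ≤ N → ∃ P : Polynomial ℤ, P ≠ 0 ∧ P.natDegree ≤ n ∧
      intPolyHeight P ≤ N ∧ |Polynomial.aeval ξ P| ≤ (N : ℝ) ^ (-(2 * (n : ℤ)) + 1)) :
    ∃ Q : Polynomial ℚ, Q ≠ 0 ∧ Q.natDegree ≤ n ∧ Polynomial.aeval ξ Q = 0 := by
  obtain ⟨N₁, hN₁⟩ := h
  have hc : (1 : ℝ) ≤ (n + 1) ^ n :=
    one_le_pow₀ (by linarith [(Nat.cast_nonneg n : (0 : ℝ) ≤ n)])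
  obtain ⟨Q, hQ0, hQn, hQ⟩ := DavenportSchmidt.exists_aeval_eq_zero (ξ := ξ) hn hc
    (N₁ := max N₁ 2) (fun N hN => by
      obtain ⟨P, hP0, hPn, hPN, hPξ⟩ := hN₁ N ((le_max_left _ _).trans hN)
      exact DavenportSchmidt.exists_isSmallAt hn ((le_max_right _ _).trans hN) hP0 hPn hPN hPξ)
  refine ⟨Q.map (algebraMap ℤ ℚ), ?_, Polynomial.natDegree_map_le.trans hQn, ?_⟩
  · exact (Polynomial.map_ne_zero_iff (algebraMap ℤ ℚ).injective_int).2 hQ0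
  · rw [Polynomial.aeval_map_algebraMap, hQ]
end

section
/- Sprindžuk's theorem: For Lebesgue-almost all real numbers ξ the following holds: for every positive integer n and every ε > 0, there are only finitely many nonzero polynomials P ∈ ℤ[X] of degree at most n with |P(ξ)| ≤ H(P)^{−n−ε}. -/
open MeasureTheory

/-- Among finitely many real intervals one can select a subfamily with the same union in which no
point lies in more than two members; hence the total length is at most twice that of an ambient
interval. -/
theorem exists_subfamily_sum_volume_Icc_le {ι : Type*} (l r : ι → ℝ) (a b : ℝ) (T : Finset ι)
    (h : ∀ i ∈ T, Set.Icc (l i) (r i) ⊆ Set.Icc a b) :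
    ∃ T' ⊆ T, (∀ x, (∃ i ∈ T, x ∈ Set.Icc (l i) (r i)) → ∃ i ∈ T', x ∈ Set.Icc (l i) (r i)) ∧
      ∑ i ∈ T', volume (Set.Icc (l i) (r i)) ≤ 2 * volume (Set.Icc a b) := by
  classical
  induction T using Finset.strongInduction with
  | H T ih =>
  by_cases hm : ∀ x, (T.filter fun i => x ∈ Set.Icc (l i) (r i)).card ≤ 2
  · refine ⟨T, subset_rfl, fun x hx => hx, ?_⟩
    calc ∑ i ∈ T, volume (Set.Icc (l i) (r i))
        = ∑ i ∈ T, ∫⁻ x, (Set.Icc (l i) (r i)).indicator 1 x := by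
          simp [lintegral_indicator_one measurableSet_Icc]
      _ = ∫⁻ x, ∑ i ∈ T, (Set.Icc (l i) (r i)).indicator 1 x := by
          rw [lintegral_finsetSum]
          intro i _
          exact measurable_one.indicator measurableSet_Icc
      _ ≤ ∫⁻ x, (Set.Icc a b).indicator (fun _ => 2) x := by
          refine lintegral_mono fun x => ?_
          by_cases hx : x ∈ Set.Icc a b
          · rw [Set.indicator_of_mem hx]
            have : ∑ i ∈ T, (Set.Icc (l i) (r i)).indicator (1 : ℝ → ENNReal) x
                = ((T.filter fun i => x ∈ Set.Icc (l i) (r i)).card : ENNReal) := by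
              simp only [Set.indicator_apply, Finset.card_filter]
              push_cast
              rfl
            rw [this]
            have := (Nat.cast_le (α := ENNReal)).2 (hm x)
            simpa using this
          · rw [Set.indicator_of_notMem hx, Finset.sum_eq_zero]
            intro i hi
            exact Set.indicator_of_notMem (fun hxi => hx (h i hi hxi)) _
      _ = 2 * volume (Set.Icc a b) := by
          rw [lintegral_indicator_const measurableSet_Icc]
  · push Not at hm
    obtain ⟨x, hx⟩ := hm
    set F := T.filter fun i => x ∈ Set.Icc (l i) (r i) with hF
    have hne : F.Nonempty := Finset.card_pos.1 (by omega)
    obtain ⟨i, hi, hil⟩ := F.exists_min_image l hne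
    obtain ⟨j, hj, hjr⟩ := F.exists_max_image r hne
    obtain ⟨k, hk, hkij⟩ : ∃ k ∈ F, k ∉ ({i, j} : Finset ι) := by
      by_contra! hcon
      have := Finset.card_le_card (s := F) (t := {i, j}) hcon
      have := Finset.card_le_two (a := i) (b := j)
      omega
    simp only [Finset.mem_insert, Finset.mem_singleton, not_or] at hkij
    have hil' := hil k hk
    have hjr' := hjr k hk
    simp only [hF, Finset.mem_filter, Set.mem_Icc] at hi hj hk
    obtain ⟨T', hT', hc, hs⟩ := ih (T.erase k) (Finset.erase_ssubset hk.1)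
      fun i hi => h i (Finset.mem_of_mem_erase hi)
    refine ⟨T', hT'.trans (Finset.erase_subset _ _), fun y hy => hc y ?_, hs⟩
    obtain ⟨s, hs, hys⟩ := hy
    by_cases hsk : s = k
    · subst hsk
      rcases le_total y x with hyx | hyx
      · exact ⟨i, Finset.mem_erase.2 ⟨fun h => hkij.1 h.symm, hi.1⟩,
          hil'.trans hys.1, hyx.trans hi.2.2⟩
      · exact ⟨j, Finset.mem_erase.2 ⟨fun h => hkij.2 h.symm, hj.1⟩,
          hj.2.1.trans hyx, hys.2.trans hjr'⟩
    · exact ⟨s, Finset.mem_erase.2 ⟨hsk, hs⟩, hys⟩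

/-- A strict inequality for a continuous function on a closed interval persists on a slightly
larger closed interval. -/
theorem exists_forall_Icc_enlarge_lt {f : ℝ → ℝ} (hf : Continuous f) {l r c : ℝ} (hlr : l ≤ r)
    (h : ∀ y ∈ Set.Icc l r, f y < c) :
    ∃ η > 0, ∀ y ∈ Set.Icc (l - η) (r + η), f y < c := by
  obtain ⟨η, hη, hsub⟩ := (isCompact_Icc (a := l) (b := r)).exists_cthickening_subset_open
    (isOpen_lt hf continuous_const) h
  refine ⟨η, hη, fun y hy => hsub ?_⟩
  refine Metric.mem_cthickening_of_dist_le y (max l (min y r)) η _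
    ⟨le_max_left _ _, max_le hlr (min_le_right _ _)⟩ ?_
  rw [Real.dist_eq, abs_le]
  rcases le_total y r with h1 | h1
  · rw [min_eq_left h1]
    rcases le_total l y with h2 | h2
    · rw [max_eq_right h2]
      constructor <;> linarith
    · rw [max_eq_left h2]
      constructor <;> linarith [hy.1]
  · rw [min_eq_right h1, max_eq_right hlr]
    constructor <;> linarith [hy.2]

/-- Around a point where some member of a finite family of continuous functions is at most `ρ`,
there is an interval on which some member is at most `ρ'` while every member reaches `ρ`. -/
theorem exists_Icc_forall_le_forall_exists_ge {P : Type*} {ψ : P → ℝ → ℝ} {S : Finset P}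
    {ρ ρ' a b x : ℝ} (hψ : ∀ s ∈ S, Continuous (ψ s)) (hρ : ρ < ρ')
    (hsup : ∀ s ∈ S, ∃ y ∈ Set.Icc a b, ρ ≤ ψ s y) (hx : x ∈ Set.Icc a b)
    (hxS : ∃ s ∈ S, ψ s x ≤ ρ) :
    ∃ l r : ℝ, Set.Icc l r ⊆ Set.Icc a b ∧ Set.Icc l r ∈ nhdsWithin x (Set.Icc a b) ∧
      ∃ s ∈ S, (∀ y ∈ Set.Icc l r, ψ s y ≤ ρ') ∧ ∀ t ∈ S, ∃ y ∈ Set.Icc l r, ρ ≤ ψ t y := by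
  set K : Set (ℝ × ℝ) := (Set.Icc a x ×ˢ Set.Icc x b) ∩
    ⋃ s ∈ S, ⋂ θ ∈ Set.Icc (0 : ℝ) 1, {p | ψ s (p.1 + θ * (p.2 - p.1)) ≤ ρ} with hK
  have hcomp : IsCompact K := by
    refine (isCompact_Icc.prod isCompact_Icc).inter_right ?_
    refine S.finite_toSet.isClosed_biUnion fun s hs => ?_
    refine isClosed_biInter fun θ _ => ?_
    exact isClosed_le ((hψ s hs).comp (by fun_prop)) continuous_const
  have hne : K.Nonempty := by
    obtain ⟨s, hs, hsx⟩ := hxS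
    refine ⟨(x, x), ⟨⟨hx.1, le_rfl⟩, le_rfl, hx.2⟩, ?_⟩
    simp only [Set.mem_iUnion, Set.mem_iInter]
    exact ⟨s, hs, fun θ _ => by simpa using hsx⟩
  obtain ⟨⟨l, r⟩, hlrK, hmax⟩ := hcomp.exists_isMaxOn hne
    (f := fun p : ℝ × ℝ => p.2 - p.1) (by fun_prop)
  obtain ⟨⟨⟨hal, hlx⟩, hxr, hrb⟩, hU⟩ := hlrK
  simp only [Set.mem_iUnion, Set.mem_iInter] at hU hal hlx hxr hrb
  obtain ⟨s, hs, hsθ⟩ := hU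
  have hlr : l ≤ r := hlx.trans hxr
  have hsle : ∀ y ∈ Set.Icc l r, ψ s y < ρ' := by
    intro y hy
    refine lt_of_le_of_lt ?_ hρ
    rcases hlr.eq_or_lt with heq | hlt
    · have := hsθ 0 (by simp)
      have hyl : y = l := le_antisymm (heq ▸ hy.2) hy.1
      simpa [hyl] using this
    · have hpos : 0 < r - l := sub_pos.2 hlt
      have := hsθ ((y - l) / (r - l)) ⟨div_nonneg (sub_nonneg.2 hy.1) hpos.le,
        (div_le_one hpos).2 (by linarith [hy.2])⟩
      simpa [div_mul_cancel₀ _ hpos.ne'] using this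
  have hex : ∀ t ∈ S, ∃ y ∈ Set.Icc l r, ρ ≤ ψ t y := by
    intro t ht
    by_contra! hcon
    obtain ⟨η, hη, hη'⟩ := exists_forall_Icc_enlarge_lt (hψ t ht) hlr hcon
    have hmem : (max a (l - η), min b (r + η)) ∈ K := by
      have h1 : max a (l - η) ≤ x := max_le hx.1 (by linarith)
      have h2 : x ≤ min b (r + η) := le_min hx.2 (by linarith)
      refine ⟨⟨⟨le_max_left _ _, h1⟩, h2, min_le_left _ _⟩, ?_⟩
      simp only [Set.mem_iUnion, Set.mem_iInter]
      refine ⟨t, ht, fun θ hθ => (hη' _ ⟨?_, ?_⟩).le⟩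
      · have := le_max_right a (l - η)
        have := mul_nonneg hθ.1 (sub_nonneg.2 (h1.trans h2))
        dsimp only
        linarith
      · have := min_le_right b (r + η)
        have := mul_nonneg (sub_nonneg.2 hθ.2) (sub_nonneg.2 (h1.trans h2))
        dsimp only
        linarith
    have hle : min b (r + η) - max a (l - η) ≤ r - l := hmax hmem
    have h1 : max a (l - η) ≤ l := max_le hal (by linarith)
    have h2 : r ≤ min b (r + η) := le_min hrb (by linarith)
    have hla : l = a := by
      rcases le_total a (l - η) with h | h
      · rw [max_eq_right h] at hle; linarith
      · rw [max_eq_left h] at hle; linarith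
    have hrb' : r = b := by
      rcases le_total b (r + η) with h | h
      · rw [min_eq_left h] at hle; linarith
      · rw [min_eq_right h] at hle; linarith
    obtain ⟨y, hy, hy'⟩ := hsup t ht
    exact absurd (hcon y (by rwa [hla, hrb'])) (not_lt.2 hy')
  obtain ⟨η, hη, hη'⟩ := exists_forall_Icc_enlarge_lt (hψ s hs) hlr hsle
  refine ⟨max a (l - η), min b (r + η), Set.Icc_subset_Icc (le_max_left _ _) (min_le_left _ _),
    ?_, s, hs, fun y hy => (hη' y ⟨(le_max_right _ _).trans hy.1,
      hy.2.trans (min_le_right _ _)⟩).le, fun t ht => ?_⟩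
  · rw [← Set.Icc_inter_Icc]
    exact Filter.inter_mem self_mem_nhdsWithin
      (mem_nhdsWithin_of_mem_nhds (Icc_mem_nhds (by linarith) (by linarith)))
  · obtain ⟨y, hy, hy'⟩ := hex t ht
    exact ⟨y, ⟨max_le (hal.trans hy.1) (by linarith [hy.1]),
      le_min (hy.2.trans hrb) (by linarith [hy.2])⟩, hy'⟩

/-- A point `x` is marked by a chain `F` of the finite set `S` if the functions attached to `F` lie
in `[ε, 1]` at `x` and those attached to the remaining elements comparable with `F` are at least
`ρ`. -/
def IsMarked {P : Type*} [PartialOrder P] (ψ : P → ℝ → ℝ) (ε ρ : ℝ) (S : Finset P) (x : ℝ) : Prop :=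
  ∃ F ⊆ S, IsChain (· ≤ ·) (F : Set P) ∧ (∀ s ∈ F, ε ≤ ψ s x ∧ ψ s x ≤ 1) ∧
    ∀ s ∈ S, s ∉ F → (∀ t ∈ F, s ≤ t ∨ t ≤ s) → ρ ≤ ψ s x

/-- Kleinbock–Margulis estimate for the measure of the set of unmarked points. -/
theorem volume_not_isMarked_le {P : Type*} [PartialOrder P] {ψ : P → ℝ → ℝ} {ε ρ : ℝ} {κ : ENNReal}
    (hρ : ρ < 1) (rk : P → ℕ) (hrk : StrictMono rk) (R : Finset ℕ) (S : Finset P)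
    (hSR : ∀ s ∈ S, rk s ∈ R) (hψ : ∀ s ∈ S, Continuous (ψ s))
    (hgood : ∀ s ∈ S, ∀ l r : ℝ, (∃ y ∈ Set.Icc l r, ρ ≤ ψ s y) →
      volume {x ∈ Set.Icc l r | ψ s x < ε} ≤ κ * volume (Set.Icc l r))
    (a b : ℝ) (hsup : ∀ s ∈ S, ∃ y ∈ Set.Icc a b, ρ ≤ ψ s y) :
    volume {x ∈ Set.Icc a b | ¬ IsMarked ψ ε ρ S x} ≤ 4 ^ R.card * κ * volume (Set.Icc a b) := by
  classical
  induction hk : R.card generalizing R S a b with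
  | zero =>
    have hS : S = ∅ := by
      refine Finset.eq_empty_of_forall_notMem fun s hs => ?_
      have := hSR s hs
      rw [Finset.card_eq_zero.1 hk] at this
      exact Finset.notMem_empty _ this
    subst hS
    have : {x ∈ Set.Icc a b | ¬ IsMarked ψ ε ρ ∅ x} = ∅ := by
      refine Set.eq_empty_of_forall_notMem fun x hx => hx.2 ⟨∅, subset_rfl, ?_, ?_, ?_⟩ <;> simp
    rw [this]
    simp
  | succ k ih =>
    have key : ∀ x, ∃ lr : ℝ × ℝ, x ∈ Set.Icc a b → (∃ s ∈ S, ψ s x ≤ ρ) →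
        Set.Icc lr.1 lr.2 ⊆ Set.Icc a b ∧ Set.Icc lr.1 lr.2 ∈ nhdsWithin x (Set.Icc a b) ∧
        volume {x ∈ Set.Icc lr.1 lr.2 | ¬ IsMarked ψ ε ρ S x} ≤
          (4 ^ k * κ + κ) * volume (Set.Icc lr.1 lr.2) := by
      intro x
      by_cases hx : x ∈ Set.Icc a b
      swap
      · exact ⟨(0, 0), fun h => absurd h hx⟩
      by_cases hxS : ∃ s ∈ S, ψ s x ≤ ρ
      swap
      · exact ⟨(0, 0), fun _ h => absurd h hxS⟩
      obtain ⟨l, r, hsub, hnhds, s, hs, hs1, hS⟩ :=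
        exists_Icc_forall_le_forall_exists_ge hψ hρ hsup hx hxS
      refine ⟨(l, r), fun _ _ => ⟨hsub, hnhds, ?_⟩⟩
      set S' := S.filter fun t => t ≠ s ∧ (t ≤ s ∨ s ≤ t) with hS'
      have hS'S : S' ⊆ S := Finset.filter_subset _ _
      have hind := ih (R.erase (rk s)) S' (fun t ht => by
          rw [hS', Finset.mem_filter] at ht
          refine Finset.mem_erase.2 ⟨?_, hSR t ht.1⟩
          rcases ht.2.2 with h | h
          · exact (hrk (lt_of_le_of_ne h ht.2.1)).ne
          · exact (hrk (lt_of_le_of_ne h (Ne.symm ht.2.1))).ne')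
        (fun t ht => hψ t (hS'S ht)) (fun t ht => hgood t (hS'S ht)) l r
        (fun t ht => hS t (hS'S ht)) (by rw [Finset.card_erase_of_mem (hSR s hs), hk]; rfl)
      have hsubset : {x ∈ Set.Icc l r | ¬ IsMarked ψ ε ρ S x} ⊆
          {x ∈ Set.Icc l r | ¬ IsMarked ψ ε ρ S' x} ∪ {x ∈ Set.Icc l r | ψ s x < ε} := by
        rintro y ⟨hy, hyS⟩
        by_contra! hcon
        simp only [Set.mem_union, Set.mem_ofPred_eq, hy, true_and, not_or, not_not, not_lt] at hcon
        obtain ⟨⟨F, hFS, hchain, hF, hF'⟩, hε⟩ := hcon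
        refine hyS ⟨insert s F, Finset.insert_subset hs (hFS.trans hS'S), ?_, ?_, ?_⟩
        · rw [Finset.coe_insert]
          refine hchain.insert fun t ht _ => ?_
          have := (Finset.mem_filter.1 (hFS ht)).2.2
          exact this.symm
        · intro t ht
          rcases Finset.mem_insert.1 ht with rfl | ht
          · exact ⟨hε, hs1 y hy⟩
          · exact hF t ht
        · intro t ht htF hcomp
          simp only [Finset.mem_insert, not_or] at htF
          refine hF' t (Finset.mem_filter.2 ⟨ht, htF.1, hcomp s (Finset.mem_insert_self _ _)⟩)
            htF.2 fun u hu => hcomp u (Finset.mem_insert_of_mem hu)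
      calc volume {x ∈ Set.Icc l r | ¬ IsMarked ψ ε ρ S x}
          ≤ _ := (measure_mono hsubset).trans (measure_union_le _ _)
        _ ≤ _ := add_le_add hind (hgood s hs l r (hS s hs))
        _ = _ := by rw [add_mul]
    choose I hI using key
    set E : Set ℝ := Set.Icc a b ∩ ⋃ s ∈ S, {x | ψ s x ≤ ρ} with hE
    have hEcomp : IsCompact E := isCompact_Icc.inter_right
      (S.finite_toSet.isClosed_biUnion fun s hs => isClosed_le (hψ s hs) continuous_const)
    have hI' : ∀ x ∈ E, _ := fun x hx => hI x hx.1 (by simpa using hx.2)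
    obtain ⟨T, hTE, hTcov⟩ := hEcomp.elim_nhdsWithin_subcover
      (fun x => Set.Icc (I x).1 (I x).2)
      (fun x hx => nhdsWithin_mono x Set.inter_subset_left (hI' x hx).2.1)
    obtain ⟨T', hT'T, hT'cov, hT'sum⟩ := exists_subfamily_sum_volume_Icc_le
      (fun x => (I x).1) (fun x => (I x).2) a b T (fun x hx => (hI' x (hTE x hx)).1)
    have hsubset : {x ∈ Set.Icc a b | ¬ IsMarked ψ ε ρ S x} ⊆
        ⋃ i ∈ T', {x ∈ Set.Icc (I i).1 (I i).2 | ¬ IsMarked ψ ε ρ S x} := by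
      rintro x ⟨hx, hxS⟩
      have hxE : x ∈ E := by
        by_contra hcon
        have hcon' : ∀ s ∈ S, ρ < ψ s x := by
          intro s hs
          by_contra! h
          exact hcon ⟨hx, Set.mem_biUnion hs h⟩
        refine hxS ⟨∅, Finset.empty_subset _, by simp, by simp, fun s hs _ _ => (hcon' s hs).le⟩
      have := hTcov hxE
      simp only [Set.mem_iUnion, exists_prop] at this
      obtain ⟨i, hi, hxi⟩ := hT'cov x this
      exact Set.mem_biUnion hi ⟨hxi, hxS⟩
    calc volume {x ∈ Set.Icc a b | ¬ IsMarked ψ ε ρ S x}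
        ≤ ∑ i ∈ T', volume {x ∈ Set.Icc (I i).1 (I i).2 | ¬ IsMarked ψ ε ρ S x} :=
          (measure_mono hsubset).trans (measure_biUnion_finset_le _ _)
      _ ≤ ∑ i ∈ T', (4 ^ k * κ + κ) * volume (Set.Icc (I i).1 (I i).2) :=
          Finset.sum_le_sum fun i hi => (hI' i (hTE i (hT'T hi))).2.2
      _ = (4 ^ k * κ + κ) * ∑ i ∈ T', volume (Set.Icc (I i).1 (I i).2) := by
          rw [Finset.mul_sum]
      _ ≤ (4 ^ k * κ + 4 ^ k * κ) * (2 * volume (Set.Icc a b)) := by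
          gcongr
          exact le_mul_of_one_le_left zero_le (one_le_pow₀ (by norm_num))
      _ = 4 ^ (k + 1) * κ * volume (Set.Icc a b) := by ring

/-- A set of large measure contains many well-spaced points. -/
theorem exists_finset_separated {E : Set ℝ} {δ : ℝ} (hδ : 0 < δ) (k : ℕ)
    (hE : k * ENNReal.ofReal (2 * δ) < volume E) :
    ∃ s : Finset ℝ, ↑s ⊆ E ∧ s.card = k + 1 ∧ ∀ x ∈ s, ∀ y ∈ s, x ≠ y → δ ≤ |x - y| := by
  classical
  induction k with
  | zero =>
    obtain ⟨x, hx⟩ : E.Nonempty := nonempty_of_measure_ne_zero (by simpa using hE.ne')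
    refine ⟨{x}, by simpa using hx, by simp, ?_⟩
    intro y hy z hz hyz
    simp only [Finset.mem_singleton] at hy hz
    exact absurd (hy.trans hz.symm) hyz
  | succ k ih =>
    obtain ⟨s, hsE, hsc, hsep⟩ := ih (lt_of_le_of_lt (by gcongr; simp) hE)
    have hlt : volume (⋃ x ∈ s, Metric.ball x δ) < volume E := by
      refine lt_of_le_of_lt ((measure_biUnion_finset_le _ _).trans (le_of_eq ?_)) hE
      simp [Real.volume_ball, hsc]
    obtain ⟨y, hyE, hy⟩ : ∃ y ∈ E, y ∉ ⋃ x ∈ s, Metric.ball x δ := by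
      by_contra! hcon
      exact absurd (measure_mono hcon) (not_le.2 hlt)
    simp only [Set.mem_iUnion, Metric.mem_ball, not_exists, not_lt, Real.dist_eq] at hy
    have hys : y ∉ s := by
      intro hys
      have := hy y hys
      simp only [sub_self, abs_zero] at this
      linarith
    refine ⟨insert y s, ?_, by rw [Finset.card_insert_of_notMem hys, hsc], ?_⟩
    · rw [Finset.coe_insert]
      exact Set.insert_subset hyE hsE
    · intro u hu v hv huv
      rcases Finset.mem_insert.1 hu with rfl | hu' <;> rcases Finset.mem_insert.1 hv with rfl | hv'
      · exact absurd rfl huv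
      · exact hy v hv'
      · rw [abs_sub_comm]
        exact hy u hu'
      · exact hsep u hu' v hv' huv

/-- Polynomials of bounded degree are small only on a small part of an interval. -/
theorem volume_abs_eval_lt_le {p : Polynomial ℝ} {d : ℕ} (hp : p.natDegree ≤ d) {ε ρ θ l r : ℝ}
    (hθ : 0 < θ) (hε : (d + 1) * ε < ρ * θ ^ d) (hy : ∃ y ∈ Set.Icc l r, ρ ≤ |p.eval y|) :
    volume {x ∈ Set.Icc l r | |p.eval x| < ε} ≤
      ENNReal.ofReal (2 * d * θ) * volume (Set.Icc l r) := by
  classical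
  obtain ⟨y, hy, hyρ⟩ := hy
  have hlr : l ≤ r := hy.1.trans hy.2
  rcases hlr.eq_or_lt with rfl | hlt
  · refine (measure_mono (Set.sep_subset _ _)).trans ?_
    simp
  by_contra! hcon
  have hpos : 0 < r - l := sub_pos.2 hlt
  set δ := θ * (r - l) with hδ
  have hδpos : 0 < δ := mul_pos hθ hpos
  obtain ⟨s, hsE, hsc, hsep⟩ := exists_finset_separated hδpos d (lt_of_le_of_lt (le_of_eq (by
    rw [Real.volume_Icc, ← ENNReal.ofReal_mul (by positivity), ← ENNReal.ofReal_natCast,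
      ← ENNReal.ofReal_mul (by positivity), hδ]
    congr 1
    ring)) hcon)
  have heq := Lagrange.eq_interpolate (s := s) (v := id) (f := p) (Function.injective_id.injOn)
    (lt_of_le_of_lt Polynomial.degree_le_natDegree (by
      rw [hsc]
      exact_mod_cast Nat.lt_succ_of_le hp))
  have hbasis : ∀ x ∈ s, |(Lagrange.basis s id x).eval y| ≤ (1 / θ) ^ d := by
    intro x hx
    have hcard : (s.erase x).card = d := by rw [Finset.card_erase_of_mem hx, hsc]; rfl
    rw [Lagrange.basis, Polynomial.eval_prod, Finset.abs_prod, ← hcard,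
      ← Finset.prod_const]
    refine Finset.prod_le_prod (fun _ _ => abs_nonneg _) fun z hz => ?_
    rw [Finset.mem_erase] at hz
    have hxz := hsep x hx z hz.2 hz.1.symm
    have hz' := (hsE hz.2).1
    simp only [Lagrange.basisDivisor, id, Polynomial.eval_mul, Polynomial.eval_C,
      Polynomial.eval_sub, Polynomial.eval_X, abs_mul, abs_inv]
    have h1 : |y - z| ≤ r - l := by
      rw [abs_le]
      constructor <;> linarith [hy.1, hy.2, hz'.1, hz'.2]
    calc |x - z|⁻¹ * |y - z| ≤ δ⁻¹ * (r - l) := by gcongr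
      _ = 1 / θ := by rw [hδ]; field_simp
  have hbound : |p.eval y| ≤ ∑ x ∈ s, ε * (1 / θ) ^ d := by
    rw [heq, Lagrange.interpolate_apply, Polynomial.eval_finsetSum]
    refine (Finset.abs_sum_le_sum_abs _ _).trans (Finset.sum_le_sum fun x hx => ?_)
    rw [Polynomial.eval_mul, Polynomial.eval_C, abs_mul]
    have h1 : |p.eval (id x)| < ε := (hsE hx).2
    exact mul_le_mul h1.le (hbasis x hx) (abs_nonneg _) ((abs_nonneg _).trans h1.le)
  rw [Finset.sum_const, hsc, nsmul_eq_mul] at hbound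
  have h2 : ρ ≤ (d + 1) * ε * (1 / θ) ^ d := by
    push_cast at hbound
    linarith
  rw [one_div, inv_pow, ← div_eq_mul_inv, le_div_iff₀ (by positivity)] at h2
  linarith

/-- On a nondegenerate interval, nonzero integer polynomial expressions of bounded degree take
values bounded away from zero. -/
theorem exists_forall_intPoly_exists_ge (m : ℕ) {a b : ℝ} (hab : a < b) :
    ∃ ρ : ℝ, 0 < ρ ∧ ρ < 1 ∧ ∀ N : Fin m → ℤ, N ≠ 0 →
      ∃ y ∈ Set.Icc a b, ρ ≤ |∑ i, (N i : ℝ) * y ^ (i : ℕ)| := by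
  set v : Fin m → ℝ := fun i => a + (b - a) * ((i : ℝ) / m) with hv
  have hinj : Function.Injective v := by
    intro i j hij
    have hm : (m : ℝ) ≠ 0 := by
      have := i.pos
      positivity
    have hba : b - a ≠ 0 := (sub_pos.2 hab).ne'
    simp only [hv, add_right_inj, mul_right_inj' hba, div_left_inj' hm, Nat.cast_inj] at hij
    exact Fin.ext hij
  have hmem : ∀ i, v i ∈ Set.Icc a b := by
    intro i
    have h1 : 0 ≤ (i : ℝ) / m := by positivity
    have h2 : (i : ℝ) / m ≤ 1 := div_le_one_of_le₀ (by exact_mod_cast i.2.le) (by positivity)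
    have h3 : 0 < b - a := sub_pos.2 hab
    constructor
    · have := mul_nonneg h3.le h1
      simp only [hv]
      linarith
    · have := mul_le_mul_of_nonneg_left h2 h3.le
      simp only [hv]
      linarith
  have hdet := Matrix.det_vandermonde_ne_zero_iff.2 hinj
  obtain ⟨K, hK, hanti⟩ := LinearMap.exists_antilipschitzWith (Matrix.vandermonde v).mulVecLin (by
    rw [LinearMap.ker_eq_bot]
    exact Matrix.mulVec_injective_iff_isUnit.2
      ((Matrix.isUnit_iff_isUnit_det _).2 hdet.isUnit))
  have hKpos : (0 : ℝ) < K := hK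
  refine ⟨min (1 / 2) (1 / (2 * K)), by positivity, by
    exact (min_le_left _ _).trans_lt (by norm_num), fun N hN => ?_⟩
  obtain ⟨i, hi⟩ := Function.ne_iff.1 hN
  by_contra! hcon
  set w : Fin m → ℝ := fun i => (N i : ℝ) with hw
  have h1 : ‖w‖ ≤ K * ‖(Matrix.vandermonde v).mulVecLin w‖ := by
    simpa using hanti.le_mul_dist w 0
  have h2 : (1 : ℝ) ≤ ‖w‖ := by
    refine le_trans ?_ (norm_le_pi_norm w i)
    simp only [hw, Real.norm_eq_abs]
    exact_mod_cast Int.one_le_abs hi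
  have h3 : ‖(Matrix.vandermonde v).mulVecLin w‖ ≤ 1 / (2 * K) := by
    refine (pi_norm_le_iff_of_nonneg (by positivity)).2 fun j => ?_
    have := hcon (v j) (hmem j)
    rw [Real.norm_eq_abs]
    refine le_trans (le_of_eq ?_) (this.le.trans (min_le_right _ _))
    simp [Matrix.mulVec, dotProduct, hw, mul_comm]
  have h4 : K * ‖(Matrix.vandermonde v).mulVecLin w‖ ≤ K * (1 / (2 * K)) := by gcongr
  have h5 : (K : ℝ) * (1 / (2 * K)) = 1 / 2 := by field_simp
  linarith

/-- The vector `(Dⁿ P(x), a₁ / D, …, aₙ / D)` attached to the integer polynomial `P` with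
coefficients `z = (a₀, …, aₙ)`. -/
noncomputable def scaledVec {n : ℕ} (D x : ℝ) (z : Fin (n + 1) → ℤ) : Fin (n + 1) → ℝ :=
  fun i => if i = 0 then D ^ n * ∑ l, (z l : ℝ) * x ^ (l : ℕ) else z i / D

/-- The maximum of the absolute values of the maximal minors of the matrix with rows
`scaledVec D x (b a)`. -/
noncomputable def maxMinor {n k : ℕ} (D : ℝ) (b : Fin k → Fin (n + 1) → ℤ) (x : ℝ) : ℝ :=
  ‖fun r : Fin k → Fin (n + 1) => (Matrix.of fun a c => scaledVec D x (b a) (r c)).det‖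

theorem maxMinor_nonneg {n k : ℕ} (D : ℝ) (b : Fin k → Fin (n + 1) → ℤ) (x : ℝ) :
    0 ≤ maxMinor D b x :=
  norm_nonneg _

theorem scaledVec_sum {n k : ℕ} (D x : ℝ) (c : Fin k → ℤ) (b : Fin k → Fin (n + 1) → ℤ) :
    scaledVec D x (∑ i, c i • b i) = ∑ i, (c i : ℝ) • scaledVec D x (b i) := by
  ext j
  simp only [scaledVec, Finset.sum_apply, Pi.smul_apply, smul_eq_mul]
  split_ifs with h
  · push_cast
    simp_rw [Finset.sum_mul, Finset.mul_sum]
    rw [Finset.sum_comm]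
    refine Finset.sum_congr rfl fun i _ => Finset.sum_congr rfl fun l _ => by ring
  · push_cast
    rw [Finset.sum_div]
    exact Finset.sum_congr rfl fun i _ => by ring

theorem continuous_maxMinor {n k : ℕ} (D : ℝ) (b : Fin k → Fin (n + 1) → ℤ) :
    Continuous (maxMinor D b) := by
  refine Continuous.norm (continuous_pi fun r => Continuous.matrix_det ?_)
  refine continuous_pi fun a => continuous_pi fun c => ?_
  simp only [Matrix.of_apply, scaledVec]
  split_ifs
  · fun_prop
  · fun_prop

theorem exists_polynomial_eval_minor {n k : ℕ} (D : ℝ) (b : Fin k → Fin (n + 1) → ℤ)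
    (r : Fin k → Fin (n + 1)) :
    ∃ p : Polynomial ℝ, p.natDegree ≤ k * n ∧
      ∀ x, p.eval x = (Matrix.of fun a c => scaledVec D x (b a) (r c)).det := by
  set M : Matrix (Fin k) (Fin k) (Polynomial ℝ) := Matrix.of fun a c =>
    if r c = 0 then Polynomial.C (D ^ n) * ∑ l, Polynomial.C (b a l : ℝ) * Polynomial.X ^ (l : ℕ)
    else Polynomial.C (b a (r c) / D) with hM
  refine ⟨M.det, ?_, fun x => ?_⟩
  · rw [Matrix.det_apply]
    refine Polynomial.natDegree_sum_le_of_forall_le _ _ fun σ _ => ?_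
    refine (Polynomial.natDegree_smul_le _ _).trans ?_
    refine (Polynomial.natDegree_prod_le _ _).trans ?_
    refine (Finset.sum_le_card_nsmul _ _ n fun i _ => ?_).trans (by simp)
    simp only [hM, Matrix.of_apply]
    split_ifs
    · refine (Polynomial.natDegree_C_mul_le _ _).trans ?_
      refine Polynomial.natDegree_sum_le_of_forall_le _ _ fun l _ => ?_
      exact (Polynomial.natDegree_C_mul_X_pow_le _ _).trans (Nat.lt_succ_iff.1 l.2)
    · simp
  · rw [← Polynomial.coe_evalRingHom, RingHom.map_det]
    congr 1
    ext a c
    simp only [hM, RingHom.mapMatrix_apply, Matrix.map_apply, Matrix.of_apply, scaledVec]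
    split_ifs <;> simp [Polynomial.eval_finsetSum]

theorem volume_maxMinor_lt_le {n k : ℕ} (D : ℝ) (b : Fin k → Fin (n + 1) → ℤ) {d : ℕ}
    (hd : k * n ≤ d) {ε ρ θ l r : ℝ} (hρ : 0 < ρ)
    (hθ : 0 < θ) (hε : (d + 1) * ε < ρ * θ ^ d) (hy : ∃ y ∈ Set.Icc l r, ρ ≤ maxMinor D b y) :
    volume {x ∈ Set.Icc l r | maxMinor D b x < ε} ≤
      ENNReal.ofReal (2 * d * θ) * volume (Set.Icc l r) := by
  obtain ⟨y, hy, hyρ⟩ := hy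
  obtain ⟨s, hs⟩ : ∃ s : Fin k → Fin (n + 1),
      ρ ≤ ‖(Matrix.of fun a c => scaledVec D y (b a) (s c)).det‖ := by
    by_contra! hcon
    exact absurd hyρ (not_le.2 ((pi_norm_lt_iff hρ).2 hcon))
  obtain ⟨p, hp, hpe⟩ := exists_polynomial_eval_minor D b s
  refine le_trans (measure_mono ?_) (volume_abs_eval_lt_le (hp.trans hd) hθ hε
    ⟨y, hy, by rwa [hpe]⟩)
  rintro x ⟨hx, hxε⟩
  refine ⟨hx, lt_of_le_of_lt ?_ hxε⟩
  rw [hpe, ← Real.norm_eq_abs]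
  exact norm_le_pi_norm
    (fun r : Fin k → Fin (n + 1) => (Matrix.of fun a c => scaledVec D x (b a) (r c)).det) s

theorem maxMinor_cons_le {n k : ℕ} (D x : ℝ) (v : Fin (n + 1) → ℤ)
    (b : Fin k → Fin (n + 1) → ℤ) :
    maxMinor D (Fin.cons v b : Fin (k + 1) → Fin (n + 1) → ℤ) x ≤
      (k + 1) * (‖scaledVec D x v‖ * maxMinor D b x) := by
  refine (pi_norm_le_iff_of_nonneg (mul_nonneg (by positivity)
    (mul_nonneg (norm_nonneg _) (norm_nonneg _)))).2 fun r => ?_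
  rw [Matrix.det_succ_row_zero]
  refine (norm_sum_le _ _).trans ?_
  refine (Finset.sum_le_card_nsmul _ _ (‖scaledVec D x v‖ * maxMinor D b x) fun j _ => ?_).trans_eq
    (by rw [Finset.card_univ, Fintype.card_fin, nsmul_eq_mul, Nat.cast_succ]; rfl)
  rw [norm_mul, norm_mul, norm_pow, norm_neg, norm_one, one_pow, one_mul]
  refine mul_le_mul (norm_le_pi_norm (scaledVec D x v) (r j)) ?_ (norm_nonneg _) (norm_nonneg _)
  exact norm_le_pi_norm
    (fun r : Fin k → Fin (n + 1) => (Matrix.of fun a c => scaledVec D x (b a) (r c)).det)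
    (fun c => r (j.succAbove c))

theorem maxMinor_le_of_linearIndependent {n k : ℕ} (D x : ℝ) {b b' : Fin k → Fin (n + 1) → ℤ}
    (hb' : LinearIndependent ℤ b') (h : ∀ i, ∃ c : Fin k → ℤ, b' i = ∑ j, c j • b j) :
    maxMinor D b x ≤ maxMinor D b' x := by
  choose M hM using h
  have hdet : (Matrix.of M).det ≠ 0 := by
    intro h0
    obtain ⟨v, hv, hvM⟩ := Matrix.exists_vecMul_eq_zero_iff.2 h0
    refine hv (funext (Fintype.linearIndependent_iff.1 hb' v ?_))
    simp_rw [hM, Finset.smul_sum, smul_smul]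
    rw [Finset.sum_comm]
    refine Finset.sum_eq_zero fun j _ => ?_
    rw [← Finset.sum_smul]
    have := congrFun hvM j
    simp only [Matrix.vecMul, dotProduct, Matrix.of_apply, Pi.zero_apply] at this
    rw [this, zero_smul]
  refine (pi_norm_le_iff_of_nonneg (maxMinor_nonneg _ _ _)).2 fun r => ?_
  have heq : (Matrix.of fun a c => scaledVec D x (b' a) (r c)) =
      ((Matrix.of M).map (Int.castRingHom ℝ)) *
        (Matrix.of fun a c => scaledVec D x (b a) (r c)) := by
    ext a c
    rw [Matrix.of_apply, hM, scaledVec_sum, Finset.sum_apply]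
    simp [Matrix.mul_apply]
  have hle : ‖(Matrix.of fun a c => scaledVec D x (b' a) (r c)).det‖ ≤ maxMinor D b' x :=
    norm_le_pi_norm
      (fun r : Fin k → Fin (n + 1) => (Matrix.of fun a c => scaledVec D x (b' a) (r c)).det) r
  refine le_trans ?_ hle
  rw [heq, Matrix.det_mul, norm_mul]
  refine le_mul_of_one_le_left (norm_nonneg _) ?_
  rw [← RingHom.mapMatrix_apply, ← RingHom.map_det, Real.norm_eq_abs]
  simp only [eq_intCast]
  exact_mod_cast Int.one_le_abs hdet

/-- A matrix over a field with linearly independent rows has a nonzero maximal minor. -/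
theorem exists_minor_ne_zero {K : Type*} [Field K] {k m : ℕ} {B : Fin k → Fin m → K}
    (hB : LinearIndependent K B) :
    ∃ r : Fin k → Fin m, (Matrix.of fun a c => B a (r c)).det ≠ 0 := by
  by_contra! hcon
  obtain ⟨g, hg⟩ := (Fintype.linearCombination K B).exists_leftInverse_of_injective
    (LinearMap.ker_eq_bot.2 hB.fintypeLinearCombination_injective)
  have hgB : ∀ i, g (B i) = Pi.single i 1 := by
    intro i
    have := LinearMap.congr_fun hg (Pi.single i 1)
    simpa [Fintype.linearCombination_apply_single] using this
  set C : Fin m → Fin k → K := fun l => g (Pi.single l 1) with hC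
  have hone : (fun c => ∑ l, C l c • fun a => B a l) =
      fun c => (1 : Matrix (Fin k) (Fin k) K) c := by
    ext c a
    have h1 : g (B a) c = ∑ l, B a l * C l c := by
      conv_lhs => rw [pi_eq_sum_univ' (B a)]
      simp [hC, Finset.sum_apply, Pi.single]
    rw [hgB] at h1
    simp only [Finset.sum_apply, Pi.smul_apply, smul_eq_mul, Matrix.one_apply]
    rw [Finset.sum_congr rfl fun l _ => mul_comm _ _, ← h1, Pi.single_apply]
  have hdet := (Matrix.detRowAlternating (n := Fin k) (R := K)).toMultilinearMap.map_sum
    (fun c l => C l c • fun a => B a l)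
  rw [hone] at hdet
  have h0 : ∀ r : Fin k → Fin m, (Matrix.detRowAlternating (n := Fin k) (R := K)).toMultilinearMap
      (fun c => C (r c) c • fun a => B a (r c)) = 0 := by
    intro r
    rw [MultilinearMap.map_smul_univ]
    have h2 := hcon r
    rw [← Matrix.det_transpose] at h2
    exact (congrArg _ h2).trans (smul_zero _)
  rw [Finset.sum_eq_zero fun r _ => h0 r] at hdet
  have h3 : (1 : Matrix (Fin k) (Fin k) K).det = 0 := hdet
  simp at h3

theorem exists_le_maxMinor {n k : ℕ} {D : ℝ} (hD : 1 ≤ D) (hk : 0 < k)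
    {b : Fin k → Fin (n + 1) → ℤ} (hb : LinearIndependent ℚ fun a i => (b a i : ℚ)) {a₀ b₀ ρ : ℝ}
    (hρ : ∀ N : Fin (n + 1) → ℤ, N ≠ 0 →
      ∃ y ∈ Set.Icc a₀ b₀, ρ ≤ |∑ i, (N i : ℝ) * y ^ (i : ℕ)|) :
    ∃ y ∈ Set.Icc a₀ b₀, ρ ≤ maxMinor D b y := by
  obtain ⟨r, hr⟩ := exists_minor_ne_zero hb
  have hrinj : Function.Injective r := by
    intro c c' hcc
    by_contra hne
    exact hr (Matrix.det_zero_of_column_eq hne fun a => by simp [hcc])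
  have hkn : k ≤ n + 1 := by simpa using Fintype.card_le_of_injective r hrinj
  obtain ⟨c₀, hc₀⟩ : ∃ c₀, ∀ c, c ≠ c₀ → r c ≠ 0 := by
    by_cases h : ∃ c, r c = 0
    · obtain ⟨c₀, h0⟩ := h
      exact ⟨c₀, fun c hc hc0 => hc (hrinj (hc0.trans h0.symm))⟩
    · push Not at h
      exact ⟨⟨0, hk⟩, fun c _ => h c⟩
  set N : Fin (n + 1) → ℤ := fun l =>
    (Matrix.of fun a c => b a (Function.update r c₀ l c)).det with hN
  obtain ⟨y, hy, hyρ⟩ := hρ N (fun h0 => hr (by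
    have := congrFun h0 (r c₀)
    simp only [hN, Function.update_eq_self, Pi.zero_apply] at this
    have h2 := congrArg (Int.castRingHom ℚ) this
    rw [RingHom.map_det, map_zero] at h2
    exact h2))
  refine ⟨y, hy, hyρ.trans ?_⟩
  set s : Fin k → ℝ := fun c => if c = c₀ then D ^ n else D⁻¹ with hs
  set G : Matrix (Fin k) (Fin k) ℝ := Matrix.of fun a c => (b a (r c) : ℝ) with hG
  have hNl : ∀ l, (N l : ℝ) = G.cramer (fun a => (b a l : ℝ)) c₀ := by
    intro l
    rw [Matrix.cramer_apply, hN, ← eq_intCast (Int.castRingHom ℝ), RingHom.map_det]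
    congr 1
    ext a c
    by_cases hc : c = c₀
    · subst hc; simp
    · simp [hc, hG]
  have hdet : (Matrix.of fun a c => scaledVec D y (b a) (Function.update r c₀ 0 c)).det =
      (∏ c, s c) * ∑ l, (N l : ℝ) * y ^ (l : ℕ) := by
    have h1 : ∑ l, (N l : ℝ) * y ^ (l : ℕ) =
        G.cramer (fun a => ∑ l : Fin (n + 1), (b a l : ℝ) * y ^ (l : ℕ)) c₀ := by
      have : (fun a => ∑ l : Fin (n + 1), (b a l : ℝ) * y ^ (l : ℕ)) =
          ∑ l : Fin (n + 1), y ^ (l : ℕ) • fun a => (b a l : ℝ) := by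
        ext a
        simp [Finset.sum_apply, mul_comm]
      rw [this, map_sum, Finset.sum_apply]
      refine Finset.sum_congr rfl fun l _ => ?_
      rw [map_smul, Pi.smul_apply, hNl, smul_eq_mul, mul_comm]
    rw [h1, Matrix.cramer_apply, ← Matrix.det_mul_row]
    congr 1
    ext a c
    by_cases hc : c = c₀
    · subst hc; simp [scaledVec, hs]
    · simp [hc, hG, scaledVec, hs, hc₀ c hc, div_eq_inv_mul]
  have hD0 : 0 < D := by linarith
  have hprod : 1 ≤ ∏ c, s c := by
    rw [← Finset.mul_prod_erase _ _ (Finset.mem_univ c₀)]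
    rw [Finset.prod_congr rfl (g := fun _ => D⁻¹) (fun c hc => by
      simp [hs, (Finset.mem_erase.1 hc).1]), Finset.prod_const,
      Finset.card_erase_of_mem (Finset.mem_univ _)]
    simp only [hs, if_true, Finset.card_univ, Fintype.card_fin, inv_pow]
    rw [← div_eq_mul_inv, one_le_div (by positivity)]
    exact pow_le_pow_right₀ hD (by omega)
  have hle : ‖(Matrix.of fun a c => scaledVec D y (b a) (Function.update r c₀ 0 c)).det‖ ≤
      maxMinor D b y :=
    norm_le_pi_norm
      (fun r : Fin k → Fin (n + 1) => (Matrix.of fun a c => scaledVec D y (b a) (r c)).det) _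
  refine le_trans ?_ hle
  rw [hdet, norm_mul, Real.norm_eq_abs, Real.norm_eq_abs]
  exact le_mul_of_one_le_left (abs_nonneg _) (hprod.trans (le_abs_self _))

/-- The inclusion of integer vectors into rational vectors. -/
noncomputable def ratVec (m : ℕ) : (Fin m → ℤ) →ₗ[ℤ] (Fin m → ℚ) :=
  (Int.castAddHom ℚ).toIntLinearMap.compLeft (Fin m)

theorem ratVec_injective (m : ℕ) : Function.Injective (ratVec m) := by
  intro z w h
  ext i
  exact Int.cast_injective (α := ℚ) (congrFun h i)

/-- `b` is a basis of the lattice of integer points of the rational subspace `W`, which it spans. -/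
structure IsIntegralBasis {m k : ℕ} (W : Submodule ℚ (Fin m → ℚ)) (b : Fin k → Fin m → ℤ) :
    Prop where
  linearIndependent : LinearIndependent ℚ (ratVec m ∘ b)
  span_eq : Submodule.span ℚ (Set.range (ratVec m ∘ b)) = W
  exists_eq_sum : ∀ z, ratVec m z ∈ W → ∃ c : Fin k → ℤ, z = ∑ i, c i • b i

theorem IsIntegralBasis.finrank_eq {m k : ℕ} {W : Submodule ℚ (Fin m → ℚ)}
    {b : Fin k → Fin m → ℤ} (h : IsIntegralBasis W b) : Module.finrank ℚ W = k := by
  rw [← h.span_eq, finrank_span_eq_card h.linearIndependent, Fintype.card_fin]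

theorem exists_isIntegralBasis {m : ℕ} (T : Set (Fin m → ℤ)) :
    ∃ (k : ℕ) (b : Fin k → Fin m → ℤ),
      IsIntegralBasis (Submodule.span ℚ (ratVec m '' T)) b := by
  set W := Submodule.span ℚ (ratVec m '' T) with hW
  set L : Submodule ℤ (Fin m → ℤ) := (W.restrictScalars ℤ).comap (ratVec m) with hL
  obtain ⟨k, B⟩ := Submodule.basisOfPid (Pi.basisFun ℤ (Fin m)) L
  have hsum : ∀ z, ratVec m z ∈ W → ∃ c : Fin k → ℤ, z = ∑ i, c i • (B i : Fin m → ℤ) := by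
    intro z hz
    have hzL : z ∈ L := hz
    refine ⟨B.repr ⟨z, hzL⟩, ?_⟩
    have h := congrArg L.subtype (B.sum_repr ⟨z, hzL⟩)
    rw [map_sum] at h
    exact h.symm
  refine ⟨k, fun i => B i, ?_, ?_, hsum⟩
  · rw [← LinearIndependent.iff_fractionRing ℤ ℚ]
    have h1 := B.linearIndependent.map' L.subtype (Submodule.ker_subtype L)
    exact h1.map' (ratVec m) (LinearMap.ker_eq_bot.2 (ratVec_injective m))
  · refine le_antisymm (Submodule.span_le.2 ?_) (Submodule.span_le.2 ?_)
    · rintro _ ⟨i, rfl⟩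
      exact (B i).2
    · rintro _ ⟨z, hz, rfl⟩
      obtain ⟨c, hc⟩ := hsum z (Submodule.subset_span ⟨z, hz, rfl⟩)
      rw [hc, map_sum]
      refine Submodule.sum_mem _ fun i _ => ?_
      rw [map_zsmul]
      exact Submodule.smul_of_tower_mem _ _ (Submodule.subset_span ⟨i, rfl⟩)

theorem IsIntegralBasis.maxMinor_le {n k k' : ℕ} {W : Submodule ℚ (Fin (n + 1) → ℚ)}
    {b : Fin k → Fin (n + 1) → ℤ} (h : IsIntegralBasis W b) (D x : ℝ)
    {b' : Fin k' → Fin (n + 1) → ℤ} (hb' : LinearIndependent ℚ (ratVec (n + 1) ∘ b'))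
    (hmem : ∀ i, ratVec (n + 1) (b' i) ∈ W) (hk : k = k') :
    maxMinor D b x ≤ maxMinor D b' x := by
  subst hk
  refine maxMinor_le_of_linearIndependent D x ?_ fun i => h.exists_eq_sum _ (hmem i)
  rw [← LinearIndependent.iff_fractionRing ℤ ℚ] at hb'
  exact hb'.of_comp

/-- Adjoining an integer vector `v` to a rational subspace multiplies the covolume of its lattice of
integer points by at most a constant times the norm of `v`. -/
theorem IsIntegralBasis.maxMinor_sup_span_le {n k k' : ℕ}
    {W W' : Submodule ℚ (Fin (n + 1) → ℚ)} {b : Fin k → Fin (n + 1) → ℤ}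
    {b' : Fin k' → Fin (n + 1) → ℤ} (h : IsIntegralBasis W b) (h' : IsIntegralBasis W' b')
    {v : Fin (n + 1) → ℤ} (hv : ratVec (n + 1) v ∉ W)
    (hW' : W' = Submodule.span ℚ {ratVec (n + 1) v} ⊔ W) (D x : ℝ) :
    maxMinor D b' x ≤ (n + 1) * (‖scaledVec D x v‖ * maxMinor D b x) := by
  set w : Fin (k + 1) → Fin (n + 1) → ℤ := Fin.cons v b with hw
  have hcons : ratVec (n + 1) ∘ w = Fin.cons (ratVec (n + 1) v) (ratVec (n + 1) ∘ b) := by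
    ext i : 1
    refine Fin.cases ?_ (fun i => ?_) i <;> simp [hw]
  have hind : LinearIndependent ℚ (ratVec (n + 1) ∘ w) := by
    rw [hcons, linearIndependent_finCons]
    exact ⟨h.linearIndependent, by rwa [h.span_eq]⟩
  have hspan : Submodule.span ℚ (Set.range (ratVec (n + 1) ∘ w)) = W' := by
    rw [hcons, Fin.range_cons, Submodule.span_insert, h.span_eq, hW']
  have hk : k' = k + 1 := by
    rw [← h'.finrank_eq, ← hspan, finrank_span_eq_card hind, Fintype.card_fin]
  have hkn : k + 1 ≤ n + 1 := by
    rw [← hk, ← h'.finrank_eq]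
    simpa using Submodule.finrank_le W'
  refine (h'.maxMinor_le D x hind (fun i => ?_) hk).trans ((maxMinor_cons_le D x v b).trans ?_)
  · rw [← hspan]
    exact Submodule.subset_span ⟨i, rfl⟩
  · have := maxMinor_nonneg D b x
    gcongr
    omega

/-- Uniform nondivergence estimate: outside a small set of `x` the integer vectors `v` all have
`scaledVec D x v` bounded below. -/
theorem volume_exists_norm_scaledVec_lt_le {n : ℕ} {D a b ε ρ θ : ℝ} (hD : 1 ≤ D) (hρ0 : 0 < ρ)
    (hρ1 : ρ < 1) (hρ : ∀ N : Fin (n + 1) → ℤ, N ≠ 0 →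
      ∃ y ∈ Set.Icc a b, ρ ≤ |∑ i, (N i : ℝ) * y ^ (i : ℕ)|)
    (hερ : ε ≤ ρ) (hθ : 0 < θ)
    (hε : (((n + 1) * n : ℕ) + 1) * ε < ρ * θ ^ ((n + 1) * n))
    (V : Finset (Fin (n + 1) → ℤ)) (hV : ∀ v ∈ V, v ≠ 0) :
    volume {x ∈ Set.Icc a b | ∃ v ∈ V, (n + 1) * ‖scaledVec D x v‖ < ε} ≤
      4 ^ (n + 1) * ENNReal.ofReal (2 * ((n + 1) * n : ℕ) * θ) * volume (Set.Icc a b) := by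
  classical
  set ι := ratVec (n + 1) with hι
  set S₀ : Finset (Submodule ℚ (Fin (n + 1) → ℚ)) :=
    V.powerset.image fun T : Finset (Fin (n + 1) → ℤ) =>
      Submodule.span ℚ (ι '' (T : Set _)) with hS₀
  have hbasis : ∀ W, ∃ (k : ℕ) (b : Fin k → Fin (n + 1) → ℤ), W ∈ S₀ → IsIntegralBasis W b := by
    intro W
    by_cases hW : W ∈ S₀
    · obtain ⟨T, _, rfl⟩ := Finset.mem_image.1 hW
      obtain ⟨k, b, hb⟩ := exists_isIntegralBasis (T : Set (Fin (n + 1) → ℤ))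
      exact ⟨k, b, fun _ => hb⟩
    · exact ⟨0, Fin.elim0, fun h => absurd h hW⟩
  choose k B hB using hbasis
  set S := S₀.filter (· ≠ ⊥) with hS
  have hSS₀ : S ⊆ S₀ := Finset.filter_subset _ _
  have hfin : ∀ W : Submodule ℚ (Fin (n + 1) → ℚ), Module.finrank ℚ W ≤ n + 1 := fun W => by
    simpa using Submodule.finrank_le W
  have hpos : ∀ W ∈ S, 0 < Module.finrank ℚ W := by
    intro W hW
    rw [Nat.pos_iff_ne_zero, Ne, Submodule.finrank_eq_zero]
    exact (Finset.mem_filter.1 hW).2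
  have hmain := volume_not_isMarked_le (ψ := fun W => maxMinor D (B W)) (ε := ε) (ρ := ρ)
    (κ := ENNReal.ofReal (2 * ((n + 1) * n : ℕ) * θ)) hρ1
    (fun W : Submodule ℚ (Fin (n + 1) → ℚ) => Module.finrank ℚ W) Submodule.finrank_strictMono
    (Finset.Icc 1 (n + 1)) S (fun W hW => Finset.mem_Icc.2 ⟨hpos W hW, hfin W⟩)
    (fun W _ => continuous_maxMinor D (B W))
    (fun W hW l r hy => volume_maxMinor_lt_le D (B W) (Nat.mul_le_mul_right n (by
      rw [← (hB W (hSS₀ hW)).finrank_eq]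
      exact hfin W)) hρ0 hθ hε hy)
    a b
    (fun W hW => exists_le_maxMinor hD (by
      rw [← (hB W (hSS₀ hW)).finrank_eq]
      exact hpos W hW) (hB W (hSS₀ hW)).linearIndependent hρ)
  rw [Nat.card_Icc, Nat.add_sub_cancel] at hmain
  refine le_trans (measure_mono ?_) hmain
  rintro x ⟨hx, v, hvV, hvx⟩
  refine ⟨hx, ?_⟩
  rintro ⟨F, hFS, hchain, hF, hF'⟩
  have hbot : ⊥ ∈ S₀ := Finset.mem_image.2 ⟨∅, by simp, by simp⟩
  have hv0 : ι v ≠ 0 := fun h => hV v hvV (ratVec_injective _ (h.trans (map_zero _).symm))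
  obtain ⟨Γ, hΓS, hvΓ, hΓ1, hΓ⟩ : ∃ Γ ∈ S₀, ι v ∉ Γ ∧ maxMinor D (B Γ) x ≤ 1 ∧
      ∀ W ∈ F, W ≤ Γ ∨ Γ ≤ W ∧ ι v ∈ W := by
    by_cases hne : (F.filter fun W => ι v ∉ W).Nonempty
    · obtain ⟨Γ, hΓ, hmax⟩ := Finset.exists_max_image _
        (fun W : Submodule ℚ (Fin (n + 1) → ℚ) => Module.finrank ℚ W) hne
      rw [Finset.mem_filter] at hΓ
      refine ⟨Γ, hSS₀ (hFS hΓ.1), hΓ.2, (hF Γ hΓ.1).2, fun W hW => ?_⟩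
      rcases hchain.total hW hΓ.1 with h | h
      · exact Or.inl h
      · by_cases hvW : ι v ∈ W
        · exact Or.inr ⟨h, hvW⟩
        · have := hmax W (Finset.mem_filter.2 ⟨hW, hvW⟩)
          exact Or.inl (Submodule.eq_of_le_of_finrank_le h this).ge
    · refine ⟨⊥, hbot, by simpa using hv0, ?_, fun W hW => Or.inr ⟨bot_le, ?_⟩⟩
      · have h0 : k ⊥ = 0 := by
          rw [← (hB ⊥ hbot).finrank_eq, finrank_bot]
        have : IsEmpty (Fin (k ⊥)) := by
          rw [h0]
          infer_instance
        refine (pi_norm_le_iff_of_nonneg zero_le_one).2 fun r => ?_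
        rw [Matrix.det_isEmpty, norm_one]
      · by_contra hvW
        exact hne ⟨W, Finset.mem_filter.2 ⟨hW, hvW⟩⟩
  set Δ := Submodule.span ℚ {ι v} ⊔ Γ with hΔ
  have hΔS₀ : Δ ∈ S₀ := by
    obtain ⟨T, hT, rfl⟩ := Finset.mem_image.1 hΓS
    refine Finset.mem_image.2 ⟨insert v T, ?_, ?_⟩
    · exact Finset.mem_powerset.2 (Finset.insert_subset hvV (Finset.mem_powerset.1 hT))
    · rw [Finset.coe_insert, Set.image_insert_eq, Submodule.span_insert]
  have hvΔ : ι v ∈ Δ := Submodule.mem_sup_left (Submodule.mem_span_singleton_self _)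
  have hΔS : Δ ∈ S := Finset.mem_filter.2 ⟨hΔS₀, fun h => hv0 (by
    rw [h] at hvΔ
    exact (Submodule.mem_bot ℚ).1 hvΔ)⟩
  have hΔε : ε ≤ maxMinor D (B Δ) x := by
    by_cases hΔF : Δ ∈ F
    · exact (hF Δ hΔF).1
    · refine hερ.trans (hF' Δ hΔS hΔF fun W hW => ?_)
      rcases hΓ W hW with h | ⟨h, hvW⟩
      · exact Or.inr (h.trans le_sup_right)
      · exact Or.inl (sup_le ((Submodule.span_singleton_le_iff_mem _ _).2 hvW) h)
  have h1 := (hB Γ hΓS).maxMinor_sup_span_le (hB Δ hΔS₀) hvΓ hΔ D x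
  have h2 : ‖scaledVec D x v‖ * maxMinor D (B Γ) x ≤ ‖scaledVec D x v‖ :=
    mul_le_of_le_one_right (norm_nonneg _) hΓ1
  have h3 : ((n : ℝ) + 1) * (‖scaledVec D x v‖ * maxMinor D (B Γ) x) ≤
      (n + 1) * ‖scaledVec D x v‖ := by gcongr
  linarith

theorem natAbs_coeff_le_intPolyHeight (P : Polynomial ℤ) (i : ℕ) :
    (P.coeff i).natAbs ≤ intPolyHeight P := by
  by_cases hi : i ≤ P.natDegree
  · exact Finset.le_sup (f := fun i => (P.coeff i).natAbs)
      (Finset.mem_range.2 (Nat.lt_succ_of_le hi))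
  · simp [Polynomial.coeff_eq_zero_of_natDegree_lt (not_le.1 hi)]

theorem one_le_intPolyHeight {P : Polynomial ℤ} (hP : P ≠ 0) : 1 ≤ intPolyHeight P :=
  (Int.natAbs_pos.2 (Polynomial.leadingCoeff_ne_zero.2 hP)).trans_le
    (natAbs_coeff_le_intPolyHeight P _)

theorem finite_setOf_intPolyHeight_lt (n B : ℕ) :
    {P : Polynomial ℤ | P.natDegree ≤ n ∧ intPolyHeight P < B}.Finite := by
  refine Set.Finite.of_injOn (f := fun P (i : Fin (n + 1)) => P.coeff i)
    (t := {f | ∀ i, f i ∈ Set.Icc (-(B : ℤ)) B}) ?_ ?_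
    (Set.Finite.pi' fun _ => Set.finite_Icc _ _)
  · rintro P ⟨-, hP⟩ i
    have := natAbs_coeff_le_intPolyHeight P i
    exact ⟨by dsimp only; omega, by dsimp only; omega⟩
  · rintro P ⟨hP, -⟩ Q ⟨hQ, -⟩ hPQ
    ext i
    by_cases hi : i ≤ n
    · exact congrFun hPQ ⟨i, Nat.lt_succ_of_le hi⟩
    · rw [Polynomial.coeff_eq_zero_of_natDegree_lt (hP.trans_lt (not_le.1 hi)),
        Polynomial.coeff_eq_zero_of_natDegree_lt (hQ.trans_lt (not_le.1 hi))]

/-- If `P` takes a very small value at `ξ`, then its scaled coefficient vector is short. -/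
theorem norm_scaledVec_coeff_le {n j e : ℕ} {δ q ξ : ℝ} (hδ : 0 < δ) (hq : 0 < q)
    (hqδ : q ^ (e * (n + 1)) = (2 : ℝ) ^ (-δ)) {P : Polynomial ℤ} (hP : P.natDegree ≤ n)
    (hj : 2 ^ j ≤ intPolyHeight P) (hj' : intPolyHeight P < 2 ^ (j + 1))
    (hξ : |Polynomial.aeval ξ P| ≤ (intPolyHeight P : ℝ) ^ (-(n : ℝ) - δ)) :
    ‖scaledVec ((2 / q ^ e) ^ j) ξ (fun i : Fin (n + 1) => P.coeff i)‖ ≤ 2 * (q ^ e) ^ j := by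
  have hpow : (intPolyHeight P : ℝ) ^ (-(n : ℝ) - δ) ≤ (q ^ (e * (n + 1)) / 2 ^ n) ^ j := by
    have h1 : (intPolyHeight P : ℝ) ^ (-(n : ℝ) - δ) ≤ ((2 : ℝ) ^ j) ^ (-(n : ℝ) - δ) := by
      refine Real.rpow_le_rpow_of_nonpos (by positivity) (by exact_mod_cast hj) ?_
      have : (0 : ℝ) ≤ n := by positivity
      linarith
    refine h1.trans_eq ?_
    rw [← Real.rpow_pow_comm (by norm_num), hqδ, sub_eq_add_neg, Real.rpow_add (by norm_num),
      Real.rpow_neg (by norm_num), Real.rpow_natCast, div_eq_inv_mul]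
  have hval : ∑ l : Fin (n + 1), (P.coeff l : ℝ) * ξ ^ (l : ℕ) = Polynomial.aeval ξ P := by
    rw [Polynomial.aeval_eq_sum_range' (Nat.lt_succ_of_le hP),
      Fin.sum_univ_eq_sum_range (fun l => (P.coeff l : ℝ) * ξ ^ l)]
    simp
  refine (pi_norm_le_iff_of_nonneg (by positivity)).2 fun i => ?_
  simp only [scaledVec]
  split_ifs with hi
  · rw [hval, norm_mul, Real.norm_eq_abs, Real.norm_eq_abs, abs_of_pos (by positivity)]
    calc ((2 / q ^ e) ^ j) ^ n * |Polynomial.aeval ξ P|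
        ≤ ((2 / q ^ e) ^ j) ^ n * (q ^ (e * (n + 1)) / 2 ^ n) ^ j := by
          gcongr
          exact hξ.trans hpow
      _ = (q ^ e) ^ j := by
          rw [← pow_mul, mul_comm j n, pow_mul, ← mul_pow]
          congr 1
          rw [div_pow, pow_mul, pow_succ]
          field_simp
      _ ≤ 2 * (q ^ e) ^ j := le_mul_of_one_le_left (by positivity) (by norm_num)
  · rw [norm_div, Real.norm_eq_abs, Real.norm_eq_abs, abs_of_pos (a := (2 / q ^ e) ^ j)
      (by positivity), div_le_iff₀ (by positivity), mul_assoc, ← mul_pow,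
      mul_div_cancel₀ _ (by positivity)]
    have h1 := (natAbs_coeff_le_intPolyHeight P i).trans hj'.le
    rw [← Int.cast_abs, Int.abs_eq_natAbs, ← pow_succ']
    exact_mod_cast h1

theorem ae_mem_Icc_imp_finite {n : ℕ} (hn : 0 < n) {δ : ℝ} (hδ : 0 < δ) {a b : ℝ} (hab : a < b) :
    ∀ᵐ ξ ∂(volume : Measure ℝ), ξ ∈ Set.Icc a b →
      {P : Polynomial ℤ | P ≠ 0 ∧ P.natDegree ≤ n ∧
        |Polynomial.aeval ξ P| ≤ (intPolyHeight P : ℝ) ^ (-(n : ℝ) - δ)}.Finite := by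
  classical
  obtain ⟨ρ, hρ0, hρ1, hρ⟩ := exists_forall_intPoly_exists_ge (n + 1) hab
  obtain ⟨d, hd⟩ : ∃ d, d = (n + 1) * n := ⟨_, rfl⟩
  have hd0 : 0 < d := by rw [hd]; positivity
  obtain ⟨q, hq0, hq1, hqδ⟩ : ∃ q : ℝ, 0 < q ∧ q < 1 ∧ q ^ (d * 2 * (n + 1)) = (2 : ℝ) ^ (-δ) := by
    have hne : ((d * 2 * (n + 1) : ℕ) : ℝ) ≠ 0 := by positivity
    refine ⟨2 ^ (-δ / (d * 2 * (n + 1) : ℕ)), by positivity, ?_, ?_⟩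
    · exact Real.rpow_lt_one_of_one_lt_of_neg (by norm_num)
        (div_neg_of_neg_of_pos (by linarith) (by positivity))
    · rw [← Real.rpow_natCast, ← Real.rpow_mul (by norm_num), div_mul_cancel₀ _ hne]
  set ε : ℕ → ℝ := fun j => ρ * (q ^ j) ^ d / (d + 2) with hε
  set D : ℕ → ℝ := fun j => (2 / q ^ (d * 2)) ^ j with hD
  set V : ℕ → Finset (Fin (n + 1) → ℤ) := fun j =>
    (Fintype.piFinset fun _ => Finset.Icc (-2 ^ (j + 1)) (2 ^ (j + 1))).filter (· ≠ 0) with hV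
  set E : ℕ → Set ℝ := fun j =>
    {x ∈ Set.Icc a b | ∃ v ∈ V j, (n + 1) * ‖scaledVec (D j) x v‖ < ε j} with hE
  have hqj : ∀ j, (q ^ j) ^ d ≤ 1 := fun j => pow_le_one₀ (by positivity)
    (pow_le_one₀ hq0.le hq1.le)
  have hEvol : ∀ j, volume (E j) ≤ 4 ^ (n + 1) * ENNReal.ofReal (2 * d) * volume (Set.Icc a b) *
      ENNReal.ofReal q ^ j := by
    intro j
    have hDj : 1 ≤ D j := by
      refine one_le_pow₀ ((one_le_div (by positivity)).2 ?_)
      exact (pow_le_one₀ hq0.le hq1.le).trans (by norm_num)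
    have hεj : ε j ≤ ρ := by
      refine div_le_of_le_mul₀ (by positivity) hρ0.le ?_
      have : (1 : ℝ) ≤ d + 2 := by linarith [(Nat.cast_nonneg d : (0 : ℝ) ≤ d)]
      exact mul_le_mul_of_nonneg_left ((hqj j).trans this) hρ0.le
    refine (volume_exists_norm_scaledVec_lt_le hDj hρ0 hρ1 hρ hεj (pow_pos hq0 j) ?_ (V j)
      fun v hv => (Finset.mem_filter.1 hv).2).trans_eq ?_
    · rw [← hd]
      have : 0 < ρ * (q ^ j) ^ d := by positivity
      simp only [hε]
      rw [mul_div_assoc', div_lt_iff₀ (by positivity)]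
      nlinarith
    · rw [← hd, ENNReal.ofReal_mul (by positivity), ENNReal.ofReal_pow hq0.le]
      ring
  have hsum : ∑' j, volume (E j) ≠ ⊤ := by
    refine ne_top_of_le_ne_top ?_ (ENNReal.tsum_le_tsum hEvol)
    rw [ENNReal.tsum_mul_left, ENNReal.tsum_geometric]
    refine ENNReal.mul_ne_top (by simp [ENNReal.mul_eq_top]) (ENNReal.inv_ne_top.2 ?_)
    rw [← ENNReal.ofReal_one, ← ENNReal.ofReal_sub _ hq0.le]
    exact (ENNReal.ofReal_pos.2 (sub_pos.2 hq1)).ne'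
  have hsmall : ∀ᶠ j : ℕ in Filter.atTop, (n + 1) * (2 * (q ^ (d * 2)) ^ j) < ε j := by
    have hqd : q ^ d < 1 := pow_lt_one₀ hq0.le hq1 hd0.ne'
    have hlim := tendsto_pow_atTop_nhds_zero_of_lt_one (by positivity) hqd
    have hc : 0 < ρ / ((d + 2) * ((n + 1) * 2)) := by positivity
    filter_upwards [hlim.eventually (gt_mem_nhds hc)] with j hj
    have hQ : 0 < (q ^ d) ^ j := by positivity
    rw [lt_div_iff₀ (by positivity)] at hj
    have h1 : (q ^ (d * 2)) ^ j = (q ^ d) ^ j * (q ^ d) ^ j := by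
      rw [pow_mul, ← mul_pow, ← sq]
    have h2 : (q ^ j) ^ d = (q ^ d) ^ j := by rw [← pow_mul, ← pow_mul, mul_comm]
    simp only [hε]
    rw [h1, h2, lt_div_iff₀ (by positivity)]
    nlinarith
  filter_upwards [ae_eventually_notMem hsum] with ξ hξ hξab
  obtain ⟨J, hJ⟩ := Filter.eventually_atTop.1 (hξ.and hsmall)
  refine (finite_setOf_intPolyHeight_lt n (2 ^ J)).subset ?_
  rintro P ⟨hP0, hPn, hPξ⟩
  refine ⟨hPn, ?_⟩
  by_contra! hcon
  have hH := one_le_intPolyHeight hP0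
  set j := Nat.log 2 (intPolyHeight P) with hj
  have hj1 : 2 ^ j ≤ intPolyHeight P := Nat.pow_log_le_self 2 (by omega)
  have hj2 : intPolyHeight P < 2 ^ (j + 1) := Nat.lt_pow_succ_log_self (by norm_num) _
  obtain ⟨h1, h2⟩ := hJ j (Nat.le_log_of_pow_le (by norm_num) hcon)
  refine h1 ⟨hξab, fun i => P.coeff i, Finset.mem_filter.2 ⟨Fintype.mem_piFinset.2 fun i => ?_, ?_⟩,
    lt_of_le_of_lt ?_ h2⟩
  · have h3 := (natAbs_coeff_le_intPolyHeight P i).trans hj2.le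
    have h4 : ((P.coeff i).natAbs : ℤ) ≤ 2 ^ (j + 1) := by exact_mod_cast h3
    rw [Finset.mem_Icc]
    omega
  · intro h0
    refine hP0 (Polynomial.leadingCoeff_eq_zero.1 ?_)
    exact congrFun h0 ⟨P.natDegree, Nat.lt_succ_of_le hPn⟩
  · gcongr
    exact norm_scaledVec_coeff_le hδ hq0 hqδ hPn hj1 hj2 hPξ

/-- Sprindžuk's theorem. -/
theorem sprindzuk :
    ∀ᵐ ξ ∂(volume : Measure ℝ), ∀ n : ℕ, 0 < n → ∀ ε : ℝ, 0 < ε →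
      {P : Polynomial ℤ | P ≠ 0 ∧ P.natDegree ≤ n ∧
        |Polynomial.aeval ξ P| ≤ (intPolyHeight P : ℝ) ^ (-(n : ℝ) - ε)}.Finite := by
  have h : ∀ᵐ ξ ∂(volume : Measure ℝ), ∀ n : ℕ, 0 < n → ∀ N M : ℕ,
      ξ ∈ Set.Icc (-(M + 1 : ℝ)) (M + 1) → {P : Polynomial ℤ | P ≠ 0 ∧ P.natDegree ≤ n ∧
        |Polynomial.aeval ξ P| ≤ (intPolyHeight P : ℝ) ^ (-(n : ℝ) - 1 / (N + 1 : ℝ))}.Finite := by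
    refine ae_all_iff.2 fun n => ?_
    by_cases hn : 0 < n
    · simp only [hn, true_imp_iff]
      refine ae_all_iff.2 fun N => ae_all_iff.2 fun M => ?_
      refine ae_mem_Icc_imp_finite hn (by positivity) ?_
      have : (0 : ℝ) ≤ M := by positivity
      linarith
    · simp [hn]
  filter_upwards [h] with ξ hξ n hn ε hε
  obtain ⟨N, hN⟩ := exists_nat_one_div_lt hε
  obtain ⟨M, hM⟩ := exists_nat_ge |ξ|
  refine (hξ n hn N M ?_).subset ?_
  · rw [Set.mem_Icc, ← abs_le]
    linarith
  · rintro P ⟨hP0, hPn, hPξ⟩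
    refine ⟨hP0, hPn, hPξ.trans (Real.rpow_le_rpow_of_exponent_le ?_ (by linarith))⟩
    exact_mod_cast one_le_intPolyHeight hP0
end
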